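/- Degenerate discrete inf-sup estimate: there exists a constant C > 0 depending only on Ω and the mesh-regularity constant C_reg such that for every admissible regular triangulation 𝒯_h of Ω and every q_h ∈ P₁^{nc} ∩ L²₀, sup over v_h ∈ P₀ \ {0} of [−(q_h, div_h v_h)/‖v_h‖_h] ≥ C h ‖q_h‖_{1,h}. -/

import Mathlib

open scoped RealInnerProductSpace
open MeasureTheory

attribute [local instance] Classical.propDecidable

noncomputable section

/-- The Euclidean plane. -/
abbrev E2 : Type := EuclideanSpace ℝ (Fin 2)

/-- A nondegenerate (closed) triangle of the plane, given by its three
affinely independent vertices. -/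
structure Tri : Type where
  vtx : Fin 3 → E2
  indep : AffineIndependent ℝ vtx

namespace Tri

/-- The triangle as a subset of the plane: the convex hull of its vertices. -/
def carrier (t : Tri) : Set E2 := convexHull ℝ (Set.range t.vtx)

/-- The area `|K|` of the triangle. -/
def area (t : Tri) : ℝ := (volume t.carrier).toReal

/-- The centroid of the triangle. -/
def centroid (t : Tri) : E2 := Finset.centroid ℝ Finset.univ t.vtx

/-- The triangle seen as a 2-simplex. -/
def simplex (t : Tri) : Affine.Simplex ℝ E2 2 := ⟨t.vtx, t.indep⟩

/-- The circumcenter `x_K` of the triangle. -/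
def ccenter (t : Tri) : E2 := t.simplex.circumcenter

/-- `σ` (an ordered pair of distinct points) is an edge of the triangle `t`:
both of its endpoints are vertices of `t`. -/
def hasEdge (t : Tri) (σ : E2 × E2) : Prop :=
  σ.1 ≠ σ.2 ∧ σ.1 ∈ Set.range t.vtx ∧ σ.2 ∈ Set.range t.vtx

end Tri

/-- The segment of an edge. -/
def eseg (σ : E2 × E2) : Set E2 := segment ℝ σ.1 σ.2

/-- The length `|σ|` of an edge. -/
def elen (σ : E2 × E2) : ℝ := dist σ.1 σ.2

/-- The midpoint `x_σ` of an edge. -/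
def emid (σ : E2 × E2) : E2 := midpoint ℝ σ.1 σ.2

/-- Rotation by `π/2` in the plane. -/
def perp (x : E2) : E2 := (EuclideanSpace.equiv (Fin 2) ℝ).symm ![-(x 1), x 0]

/-- The unit normal `n_{K,σ}` to the edge `σ`, pointing outward of the triangle `t`. -/
def Tri.nrm (t : Tri) (σ : E2 × E2) : E2 :=
  if 0 ≤ ⟪perp (σ.2 - σ.1), emid σ - t.centroid⟫
  then (elen σ)⁻¹ • perp (σ.2 - σ.1)
  else -((elen σ)⁻¹ • perp (σ.2 - σ.1))

/-- An admissible triangulation `𝒯_h` of `Ω`, together with a registration of its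
edges (each geometric edge is recorded once, with a chosen orientation) and a labelling
`K_σ`, `L_σ` of the triangle(s) adjacent to each edge.  All interior angles of all
triangles are `< π/2`. -/
structure Mesh (Ω : Set E2) : Type where
  tris : Finset Tri
  tris_nonempty : tris.Nonempty
  edges : Finset (E2 × E2)
  Kof : E2 × E2 → Tri
  Lof : E2 × E2 → Tri
  interior_disjoint : ∀ t₁ ∈ tris, ∀ t₂ ∈ tris, t₁ ≠ t₂ →
    interior t₁.carrier ∩ interior t₂.carrier = ∅
  union_eq : ⋃ t ∈ (tris : Set Tri), t.carrier = closure Ω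
  inter_structure : ∀ t₁ ∈ tris, ∀ t₂ ∈ tris, t₁ ≠ t₂ →
    t₁.carrier ∩ t₂.carrier = ∅
    ∨ (∃ a ∈ Set.range t₁.vtx ∩ Set.range t₂.vtx, t₁.carrier ∩ t₂.carrier = {a})
    ∨ (∃ σ, t₁.hasEdge σ ∧ t₂.hasEdge σ ∧ t₁.carrier ∩ t₂.carrier = eseg σ)
  angles_lt : ∀ t ∈ tris, ∀ i j l : Fin 3, i ≠ j → i ≠ l → j ≠ l →
    EuclideanGeometry.angle (t.vtx j) (t.vtx i) (t.vtx l) < Real.pi / 2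
  edges_ne : ∀ σ ∈ edges, σ.1 ≠ σ.2
  edges_cover : ∀ t ∈ tris, ∀ i j : Fin 3, i ≠ j →
    (t.vtx i, t.vtx j) ∈ edges ∨ (t.vtx j, t.vtx i) ∈ edges
  edges_sub : ∀ σ ∈ edges, ∃ t ∈ tris, t.hasEdge σ
  edges_orient : ∀ σ ∈ edges, Prod.swap σ ∉ edges
  edges_atMostTwo : ∀ σ ∈ edges, (tris.filter fun t => t.hasEdge σ).card ≤ 2
  Kof_mem : ∀ σ ∈ edges, Kof σ ∈ tris ∧ (Kof σ).hasEdge σ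
  Lof_mem : ∀ σ ∈ edges, (tris.filter fun t => t.hasEdge σ).card = 2 →
    Lof σ ∈ tris ∧ (Lof σ).hasEdge σ ∧ Lof σ ≠ Kof σ
  ext_frontier : ∀ σ ∈ edges, (tris.filter fun t => t.hasEdge σ).card = 1 →
    eseg σ ⊆ frontier Ω

namespace Mesh

variable {Ω : Set E2} (M : Mesh Ω)

/-- The interior edges `ℰ_h^int` (shared by exactly two triangles). -/
def intEdges : Finset (E2 × E2) :=
  M.edges.filter fun σ => (M.tris.filter fun t => t.hasEdge σ).card = 2

/-- The boundary edges `ℰ_h^ext`. -/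
def extEdges : Finset (E2 × E2) :=
  M.edges.filter fun σ => (M.tris.filter fun t => t.hasEdge σ).card = 1

/-- `d_σ`: distance between the circumcenters of the two triangles sharing `σ`
(interior edges), or from the circumcenter of `K_σ` to the midpoint of `σ`
(boundary edges). -/
def dOf (σ : E2 × E2) : ℝ :=
  if (M.tris.filter fun t => t.hasEdge σ).card = 2
  then dist (M.Kof σ).ccenter (M.Lof σ).ccenter
  else dist (M.Kof σ).ccenter (emid σ)

/-- `τ_σ = |σ| / d_σ`. -/
def tau (σ : E2 × E2) : ℝ := elen σ / M.dOf σ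

/-- The mesh size `h`: the largest diameter of a circumscribed circle. -/
def meshSize : ℝ := M.tris.sup' M.tris_nonempty fun t => 2 * t.simplex.circumradius

/-- Mesh regularity with constant `C_reg`: `d_σ ≥ C_reg |σ|` and `|σ| ≥ C_reg h`. -/
def Regular (Creg : ℝ) : Prop :=
  ∀ σ ∈ M.edges, Creg * elen σ ≤ M.dOf σ ∧ Creg * M.meshSize ≤ elen σ

/-- For `σ` an edge of `t`, the triangle on the other side of `σ`. -/
def other (t : Tri) (σ : E2 × E2) : Tri := if M.Kof σ = t then M.Lof σ else M.Kof σ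

/-- The `L²(Ω)` inner product of two piecewise constant (`P₀`) fields. -/
def l2P0 (v w : Tri → E2) : ℝ := ∑ t ∈ M.tris, t.area * ⟪v t, w t⟫

/-- The `L²(Ω)` norm of a `P₀` field. -/
def l2normP0 (v : Tri → E2) : ℝ := Real.sqrt (M.l2P0 v v)

/-- The discrete `H¹` norm `‖·‖_h` on `P₀`. -/
def normh (v : Tri → E2) : ℝ :=
  Real.sqrt (∑ σ ∈ M.intEdges, M.tau σ * ‖v (M.Lof σ) - v (M.Kof σ)‖ ^ 2
    + ∑ σ ∈ M.extEdges, M.tau σ * ‖v (M.Kof σ)‖ ^ 2)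

/-- A family of affine maps (one per triangle) is in `P₁^{nc}`: the two traces agree
at the midpoint of every interior edge. -/
def IsP1nc (q : Tri → (E2 →ᵃ[ℝ] ℝ)) : Prop :=
  ∀ σ ∈ M.intEdges, q (M.Kof σ) (emid σ) = q (M.Lof σ) (emid σ)

/-- Membership in `L²₀`: the piecewise affine function has zero mean on `Ω`. -/
def MeanZero (q : Tri → (E2 →ᵃ[ℝ] ℝ)) : Prop :=
  ∑ t ∈ M.tris, ∫ x in t.carrier, q t x = 0

/-- The `L²(Ω)` inner product of two piecewise affine functions. -/
def l2P1 (q r : Tri → (E2 →ᵃ[ℝ] ℝ)) : ℝ :=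
  ∑ t ∈ M.tris, ∫ x in t.carrier, q t x * r t x

/-- The `L²(Ω)` norm of a piecewise affine function. -/
def l2normP1 (q : Tri → (E2 →ᵃ[ℝ] ℝ)) : ℝ := Real.sqrt (M.l2P1 q q)

end Mesh

/-- The gradient (a constant vector) of an affine function on the plane. -/
def gradA (f : E2 →ᵃ[ℝ] ℝ) : E2 :=
  (InnerProductSpace.toDual ℝ E2).symm (LinearMap.toContinuousLinearMap f.linear)

/-- The discrete gradient `∇_h q` of a piecewise affine function: the piecewise
constant field equal on each triangle to the gradient of the affine piece. -/
def gradh (q : Tri → (E2 →ᵃ[ℝ] ℝ)) : Tri → E2 := fun t => gradA (q t)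

/-- The (constant) divergence of an affine vector field of the plane. -/
def divA (f : E2 →ᵃ[ℝ] E2) : ℝ := LinearMap.trace ℝ E2 f.linear

/-- The normal component `(u·n_{K,σ})_σ` of a piecewise affine field on the edge `σ`
of the triangle `t` (evaluated at the midpoint of `σ`). -/
def unrm (u : Tri → (E2 →ᵃ[ℝ] E2)) (t : Tri) (σ : E2 × E2) : ℝ :=
  ⟪u t (emid σ), t.nrm σ⟫

namespace Mesh

variable {Ω : Set E2} (M : Mesh Ω)

/-- The norm `‖q‖_{1,h} = (|q|² + |∇_h q|²)^{1/2}` on `P₁^{nc}`. -/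
def norm1h (q : Tri → (E2 →ᵃ[ℝ] ℝ)) : ℝ :=
  Real.sqrt ((M.l2normP1 q) ^ 2 + (M.l2normP0 (gradh q)) ^ 2)

/-- The prescribed value of `div_h v` at the midpoint of the edge `σ`. -/
def divhImage (v : Tri → E2) (σ : E2 × E2) : ℝ :=
  if (M.tris.filter fun t => t.hasEdge σ).card = 2 then
    (3 * elen σ / ((M.Kof σ).area + (M.Lof σ).area)) *
      ⟪v (M.Lof σ) - v (M.Kof σ), (M.Kof σ).nrm σ⟫
  else
    -((3 * elen σ / (M.Kof σ).area) * ⟪v (M.Kof σ), (M.Kof σ).nrm σ⟫)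

/-- `d = div_h v`: `d` is the element of `P₁^{nc}` taking the prescribed values at
the midpoints of the edges. -/
def IsDivh (v : Tri → E2) (d : Tri → (E2 →ᵃ[ℝ] ℝ)) : Prop :=
  M.IsP1nc d ∧
    ∀ t ∈ M.tris, ∀ σ ∈ M.edges, t.hasEdge σ → d t (emid σ) = M.divhImage v σ

/-- The discrete Laplacian `Δ̃_h` on `P₀`. -/
def laph (v : Tri → E2) : Tri → E2 := fun t =>
  (t.area)⁻¹ •
    ((∑ σ ∈ M.intEdges.filter fun σ => t.hasEdge σ, M.tau σ • (v (M.other t σ) - v t))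
      - ∑ σ ∈ M.extEdges.filter fun σ => t.hasEdge σ, M.tau σ • v t)

/-- The upwind convection operator `b̃_h(u_h, v_h) ∈ P₀`. -/
def btilde (u : Tri → (E2 →ᵃ[ℝ] E2)) (v : Tri → E2) : Tri → E2 := fun t =>
  (t.area)⁻¹ • ∑ σ ∈ M.intEdges.filter fun σ => t.hasEdge σ,
    elen σ • (max (unrm u t σ) 0 • v t + min (unrm u t σ) 0 • v (M.other t σ))

/-- The trilinear form `b_h(u_h, v_h, w_h)`. -/
def bh (u : Tri → (E2 →ᵃ[ℝ] E2)) (v w : Tri → E2) : ℝ :=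
  ∑ t ∈ M.tris, t.area * ⟪w t, M.btilde u v t⟫

/-- Membership in the lowest-order Raviart–Thomas space `RT₀`: the normal component is
constant on each edge of each triangle, matches across interior edges and vanishes on
boundary edges. -/
def IsRT0 (u : Tri → (E2 →ᵃ[ℝ] E2)) : Prop :=
  (∀ t ∈ M.tris, ∀ σ ∈ M.edges, t.hasEdge σ → ∀ x ∈ eseg σ,
      ⟪u t x, t.nrm σ⟫ = unrm u t σ)
  ∧ (∀ σ ∈ M.intEdges,
      ⟪u (M.Kof σ) (emid σ), (M.Kof σ).nrm σ⟫ =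
        ⟪u (M.Lof σ) (emid σ), (M.Kof σ).nrm σ⟫)
  ∧ (∀ σ ∈ M.extEdges, unrm u (M.Kof σ) σ = 0)

/-- Membership of a piecewise constant field in `P₀ ∩ RT₀`. -/
def IsRT0const (v : Tri → E2) : Prop :=
  (∀ σ ∈ M.intEdges, ⟪v (M.Lof σ) - v (M.Kof σ), (M.Kof σ).nrm σ⟫ = 0)
  ∧ ∀ σ ∈ M.extEdges, ⟪v (M.Kof σ), (M.Kof σ).nrm σ⟫ = 0

/-- The `L²(Ω)` norm of a piecewise affine vector field. -/
def l2normRT (u : Tri → (E2 →ᵃ[ℝ] E2)) : ℝ :=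
  Real.sqrt (∑ t ∈ M.tris, ∫ x in t.carrier, ‖u t x‖ ^ 2)

end Mesh

theorem setIntegral_refTriangle {f : ℝ × ℝ → ℝ} (hf : Continuous f) :
    ∫ p in {p : ℝ × ℝ | 0 ≤ p.1 ∧ 0 ≤ p.2 ∧ p.1 + p.2 ≤ 1}, f p
      = ∫ x in (0 : ℝ)..1, ∫ y in (0 : ℝ)..(1 - x), f (x, y) := by
  have hclosed : IsClosed {p : ℝ × ℝ | 0 ≤ p.1 ∧ 0 ≤ p.2 ∧ p.1 + p.2 ≤ 1} :=
    (isClosed_le continuous_const continuous_fst).inter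
      ((isClosed_le continuous_const continuous_snd).inter
        (isClosed_le (continuous_fst.add continuous_snd) continuous_const))
  have hcompact : IsCompact {p : ℝ × ℝ | 0 ≤ p.1 ∧ 0 ≤ p.2 ∧ p.1 + p.2 ≤ 1} := by
    refine (isCompact_Icc (a := ((0 : ℝ), (0 : ℝ))) (b := (1, 1))).of_isClosed_subset hclosed ?_
    rintro ⟨x, y⟩ ⟨hx, hy, hxy⟩
    simp only at hx hy hxy
    exact ⟨⟨hx, hy⟩, ⟨by simp only; linarith, by simp only; linarith⟩⟩
  have hintg : Integrable (Set.indicator {p : ℝ × ℝ | 0 ≤ p.1 ∧ 0 ≤ p.2 ∧ p.1 + p.2 ≤ 1} f)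
      (volume.prod volume) :=
    (hf.continuousOn.integrableOn_compact hcompact).integrable_indicator hclosed.measurableSet
  rw [← integral_indicator hclosed.measurableSet, Measure.volume_eq_prod, integral_prod _ hintg,
    intervalIntegral.integral_of_le zero_le_one, ← integral_Icc_eq_integral_Ioc,
    ← integral_indicator measurableSet_Icc]
  congr 1
  ext x
  by_cases hx : x ∈ Set.Icc (0 : ℝ) 1
  · rw [Set.indicator_of_mem hx, intervalIntegral.integral_of_le (by linarith [hx.2]),
      ← integral_Icc_eq_integral_Ioc, ← integral_indicator measurableSet_Icc]
    congr 1
    ext y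
    simp only [Set.indicator_apply, Set.mem_ofPred_eq, Set.mem_Icc]
    refine if_congr ?_ rfl rfl
    have := hx.1
    constructor
    · rintro ⟨h1, h2, h3⟩; exact ⟨h2, by linarith⟩
    · rintro ⟨h2, h3⟩; exact ⟨this, h2, by linarith⟩
  · rw [Set.indicator_of_notMem hx]
    convert integral_zero ℝ ℝ with y
    refine Set.indicator_of_notMem ?_ _
    rintro ⟨h1, h2, h3⟩
    exact hx ⟨h1, by simp only at h2 h3; linarith⟩

theorem intervalIntegral_cubic (e₀ e₁ e₂ e₃ s : ℝ) :
    ∫ x in (0 : ℝ)..s, (e₀ + e₁ * x + e₂ * x ^ 2 + e₃ * x ^ 3)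
      = e₀ * s + e₁ * s ^ 2 / 2 + e₂ * s ^ 3 / 3 + e₃ * s ^ 4 / 4 := by
  rw [intervalIntegral.integral_eq_sub_of_hasDerivAt
      (f := fun x => e₀ * x + e₁ * x ^ 2 / 2 + e₂ * x ^ 3 / 3 + e₃ * x ^ 4 / 4)]
  · ring
  · intro x _
    have h0 := (hasDerivAt_id' x).const_mul e₀
    have h1 := ((hasDerivAt_pow 2 x).const_mul e₁).div_const 2
    have h2 := ((hasDerivAt_pow 3 x).const_mul e₂).div_const 3
    have h3 := ((hasDerivAt_pow 4 x).const_mul e₃).div_const 4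
    refine (((h0.add h1).add h2).add h3).congr_deriv ?_
    norm_num
    ring
  · exact Continuous.intervalIntegrable (by fun_prop) _ _

theorem setIntegral_refTriangle_mul (a b c a' b' c' : ℝ) :
    ∫ p in {p : ℝ × ℝ | 0 ≤ p.1 ∧ 0 ≤ p.2 ∧ p.1 + p.2 ≤ 1},
        (a + b * p.1 + c * p.2) * (a' + b' * p.1 + c' * p.2)
      = 1 / 6 * ((a + b / 2) * (a' + b' / 2) + (a + c / 2) * (a' + c' / 2)
          + (a + b / 2 + c / 2) * (a' + b' / 2 + c' / 2)) := by
  rw [setIntegral_refTriangle (by fun_prop)]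
  have inner : ∀ x : ℝ, ∫ y in (0 : ℝ)..(1 - x),
      (a + b * x + c * y) * (a' + b' * x + c' * y)
      = (a + b * x) * (a' + b' * x) * (1 - x)
        + ((a + b * x) * c' + c * (a' + b' * x)) * (1 - x) ^ 2 / 2
        + c * c' * (1 - x) ^ 3 / 3 := by
    intro x
    rw [← sub_eq_zero]
    have h := intervalIntegral_cubic ((a + b * x) * (a' + b' * x))
      ((a + b * x) * c' + c * (a' + b' * x)) (c * c') 0 (1 - x)
    rw [intervalIntegral.integral_congr (g := fun y => (a + b * x) * (a' + b' * x)
      + ((a + b * x) * c' + c * (a' + b' * x)) * y + c * c' * y ^ 2 + 0 * y ^ 3)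
      (fun y _ => by ring), h]
    ring
  simp only [inner]
  have key : ∀ x : ℝ, (a + b * x) * (a' + b' * x) * (1 - x)
        + ((a + b * x) * c' + c * (a' + b' * x)) * (1 - x) ^ 2 / 2
        + c * c' * (1 - x) ^ 3 / 3
      = (a * a' + (a * c' + c * a') / 2 + c * c' / 3)
        + (a * b' + b * a' - a * a' + (b * c' + c * b') / 2 - (a * c' + c * a') - c * c') * x
        + (b * b' - (a * b' + b * a') - (b * c' + c * b') + (a * c' + c * a') / 2 + c * c')
          * x ^ 2
        + ((b * c' + c * b') / 2 - b * b' - c * c' / 3) * x ^ 3 := by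
    intro x; ring
  simp only [key]
  rw [intervalIntegral_cubic]
  ring

/-- Twice the signed area of a triangle. -/
def Tri.det (t : Tri) : ℝ :=
  (t.vtx 1 0 - t.vtx 0 0) * (t.vtx 2 1 - t.vtx 0 1)
    - (t.vtx 1 1 - t.vtx 0 1) * (t.vtx 2 0 - t.vtx 0 0)

theorem affine_apply_eq (f : E2 →ᵃ[ℝ] ℝ) (p : E2) :
    f p = f 0 + (gradA f 0 * p 0 + gradA f 1 * p 1) := by
  have h : f.linear p = ⟪gradA f, p⟫ := by
    simp [gradA, InnerProductSpace.toDual_symm_apply]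
  have h2 : f p = f.linear p + f 0 := by
    have := f.map_vadd 0 p
    simpa using this
  rw [h2, h, EuclideanSpace.inner_eq_star_dotProduct]
  simp [dotProduct, Fin.sum_univ_two]
  ring

theorem affine_sub_eq (f : E2 →ᵃ[ℝ] ℝ) (p r : E2) : f p - f r = ⟪gradA f, p - r⟫ := by
  rw [affine_apply_eq f p, affine_apply_eq f r, EuclideanSpace.inner_eq_star_dotProduct]
  simp [dotProduct, Fin.sum_univ_two]
  ring

namespace Tri

/-- The vertices of a triangle as an affine basis of the plane. -/
def basis (t : Tri) : AffineBasis (Fin 3) ℝ E2 :=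
  ⟨t.vtx, t.indep, by
    rw [t.indep.affineSpan_eq_top_iff_card_eq_finrank_add_one]
    simp⟩

theorem coe_basis (t : Tri) : ⇑t.basis = t.vtx := rfl

theorem carrier_eq (t : Tri) : t.carrier = convexHull ℝ (Set.range t.basis) := rfl

theorem sum_coord_smul (t : Tri) (p : E2) :
    t.basis.coord 0 p • t.vtx 0 + t.basis.coord 1 p • t.vtx 1 + t.basis.coord 2 p • t.vtx 2
      = p := by
  have := t.basis.linear_combination_coord_eq_self p
  simpa [Fin.sum_univ_three, coe_basis] using this

theorem sum_coord (t : Tri) (p : E2) :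
    t.basis.coord 0 p + t.basis.coord 1 p + t.basis.coord 2 p = 1 := by
  have := t.basis.sum_coord_apply_eq_one p
  rwa [Fin.sum_univ_three] at this

theorem det_ne_zero (t : Tri) : t.det ≠ 0 := by
  intro h
  have key : ∀ p : E2, (t.vtx 1 0 - t.vtx 0 0) * (p 1 - t.vtx 0 1)
      - (t.vtx 1 1 - t.vtx 0 1) * (p 0 - t.vtx 0 0) = 0 := by
    intro p
    have hs := t.sum_coord p
    have hp := t.sum_coord_smul p
    have h0 := congrArg (fun v : E2 => v 0) hp
    have h1 := congrArg (fun v : E2 => v 1) hp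
    simp only [PiLp.add_apply, PiLp.smul_apply, smul_eq_mul] at h0 h1
    rw [← h0, ← h1]
    unfold det at h
    have hs' : t.basis.coord 0 p = 1 - t.basis.coord 1 p - t.basis.coord 2 p := by linarith
    rw [hs']
    linear_combination (t.basis.coord 2 p) * h
  have k0 := key (!₂[t.vtx 0 0, t.vtx 0 1 + 1])
  have k1 := key (!₂[t.vtx 0 0 + 1, t.vtx 0 1])
  simp at k0 k1
  have : t.vtx 1 = t.vtx 0 := by
    ext i
    fin_cases i
    · simpa using by linarith
    · simpa using by linarith
  exact absurd (t.indep.injective this) (by decide)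

end Tri

namespace Tri

/-- The linear part of the affine map from the reference triangle to a triangle. -/
def refLin (t : Tri) : E2 →L[ℝ] E2 :=
  LinearMap.toContinuousLinearMap (Matrix.toLpLin 2 2
    !![t.vtx 1 0 - t.vtx 0 0, t.vtx 2 0 - t.vtx 0 0; t.vtx 1 1 - t.vtx 0 1, t.vtx 2 1 - t.vtx 0 1])

theorem refLin_det (t : Tri) : t.refLin.det = t.det := by
  have h : t.refLin.det = LinearMap.det (Matrix.toLpLin 2 2
    !![t.vtx 1 0 - t.vtx 0 0, t.vtx 2 0 - t.vtx 0 0;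
      t.vtx 1 1 - t.vtx 0 1, t.vtx 2 1 - t.vtx 0 1]) := rfl
  rw [h, Matrix.toLpLin_eq_toLin, LinearMap.det_toLin, Matrix.det_fin_two_of]
  unfold det
  ring

theorem refLin_apply (t : Tri) (p : E2) :
    t.refLin p = p 0 • (t.vtx 1 - t.vtx 0) + p 1 • (t.vtx 2 - t.vtx 0) := by
  ext i
  fin_cases i <;> simp [refLin, Matrix.toLpLin_apply, dotProduct,
    Fin.sum_univ_two] <;> ring

theorem carrier_eq_image (t : Tri) :
    t.carrier = (fun p : E2 => t.vtx 0 + t.refLin p) ''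
      {p : E2 | 0 ≤ p 0 ∧ 0 ≤ p 1 ∧ p 0 + p 1 ≤ 1} := by
  rw [carrier_eq, t.basis.convexHull_eq_nonneg_coord]
  ext x
  constructor
  · intro hx
    refine ⟨!₂[t.basis.coord 1 x, t.basis.coord 2 x], ⟨?_, ?_, ?_⟩, ?_⟩
    · simpa using hx 1
    · simpa using hx 2
    · have := hx 0
      have := t.sum_coord x
      simp
      linarith
    · have hs := t.sum_coord x
      conv_rhs => rw [← t.sum_coord_smul x]
      have h0 : t.basis.coord 0 x = 1 - t.basis.coord 1 x - t.basis.coord 2 x := by linarith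
      simp only [refLin_apply]
      rw [h0]
      simp
      module
  · rintro ⟨p, ⟨h0, h1, h2⟩, rfl⟩
    have hc : ∀ i, t.basis.coord i (t.vtx 0 + t.refLin p)
        = (1 - p 0 - p 1) * t.basis.coord i (t.vtx 0) + p 0 * t.basis.coord i (t.vtx 1)
          + p 1 * t.basis.coord i (t.vtx 2) := by
      intro i
      rw [refLin_apply, affine_apply_eq, affine_apply_eq (t.basis.coord i) (t.vtx 0),
        affine_apply_eq (t.basis.coord i) (t.vtx 1), affine_apply_eq (t.basis.coord i) (t.vtx 2)]
      simp
      ring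
    intro i
    rw [hc i]
    have hnn : ∀ j, 0 ≤ t.basis.coord i (t.vtx j) := by
      intro j
      have := t.basis.coord_apply i j
      rw [coe_basis] at this
      rw [this]
      split_ifs <;> norm_num
    have := hnn 0
    have := hnn 1
    have := hnn 2
    have : 0 ≤ 1 - p 0 - p 1 := by linarith
    positivity

theorem isCompact_carrier (t : Tri) : IsCompact t.carrier :=
  (Set.finite_range t.vtx).isCompact_convexHull ℝ

theorem convex_carrier (t : Tri) : Convex ℝ t.carrier := convex_convexHull ℝ _

theorem vtx_mem_carrier (t : Tri) (i : Fin 3) : t.vtx i ∈ t.carrier :=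
  subset_convexHull ℝ _ ⟨i, rfl⟩

end Tri

/-- The identification of the Euclidean plane with `ℝ × ℝ`. -/
def planeEquiv : E2 ≃ᵐ ℝ × ℝ :=
  (MeasurableEquiv.toLp 2 (Fin 2 → ℝ)).symm.trans MeasurableEquiv.finTwoArrow

theorem planeEquiv_apply (p : E2) : planeEquiv p = (p 0, p 1) := rfl

theorem measurePreserving_planeEquiv : MeasurePreserving planeEquiv :=
  (PiLp.volume_preserving_ofLp (Fin 2)).trans (volume_preserving_finTwoArrow ℝ)

namespace Tri

theorem setIntegral_mul_eq_det (t : Tri) (f g : E2 →ᵃ[ℝ] ℝ) :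
    ∫ x in t.carrier, f x * g x = |t.det| / 6 *
      (f (midpoint ℝ (t.vtx 0) (t.vtx 1)) * g (midpoint ℝ (t.vtx 0) (t.vtx 1))
        + f (midpoint ℝ (t.vtx 0) (t.vtx 2)) * g (midpoint ℝ (t.vtx 0) (t.vtx 2))
        + f (midpoint ℝ (t.vtx 1) (t.vtx 2)) * g (midpoint ℝ (t.vtx 1) (t.vtx 2))) := by
  have hmeas : MeasurableSet {p : ℝ × ℝ | 0 ≤ p.1 ∧ 0 ≤ p.2 ∧ p.1 + p.2 ≤ 1} := by measurability
  have hT : {p : E2 | 0 ≤ p 0 ∧ 0 ≤ p 1 ∧ p 0 + p 1 ≤ 1}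
      = planeEquiv ⁻¹' {p : ℝ × ℝ | 0 ≤ p.1 ∧ 0 ≤ p.2 ∧ p.1 + p.2 ≤ 1} := rfl
  have hTm : MeasurableSet {p : E2 | 0 ≤ p 0 ∧ 0 ≤ p 1 ∧ p 0 + p 1 ≤ 1} := by
    rw [hT]; exact planeEquiv.measurable hmeas
  have hinj : Function.Injective t.refLin := by
    have hu : LinearMap.det (t.refLin : E2 →ₗ[ℝ] E2) ≠ 0 := by
      have h := t.refLin_det
      change LinearMap.det (t.refLin : E2 →ₗ[ℝ] E2) = _ at h
      rw [h]
      exact t.det_ne_zero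
    exact (LinearMap.equivOfDetNeZero (t.refLin : E2 →ₗ[ℝ] E2) hu).injective
  rw [carrier_eq_image, integral_image_eq_integral_abs_det_fderiv_smul volume hTm
    (f' := fun _ => t.refLin)
    (fun x _ => (t.refLin.hasFDerivAt.const_add (t.vtx 0)).hasFDerivWithinAt)
    (fun x _ y _ hxy => hinj (add_left_cancel hxy)), refLin_det]
  have hval : ∀ (f : E2 →ᵃ[ℝ] ℝ) (p : E2), f (t.vtx 0 + t.refLin p)
      = f (t.vtx 0) + (f (t.vtx 1) - f (t.vtx 0)) * (planeEquiv p).1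
        + (f (t.vtx 2) - f (t.vtx 0)) * (planeEquiv p).2 := by
    intro f p
    rw [refLin_apply, affine_apply_eq, affine_apply_eq f (t.vtx 0),
        affine_apply_eq f (t.vtx 1), affine_apply_eq f (t.vtx 2), planeEquiv_apply]
    simp
    ring
  have hmid : ∀ (f : E2 →ᵃ[ℝ] ℝ) (p r : E2), f (midpoint ℝ p r) = (f p + f r) / 2 := by
    intro f p r
    rw [f.map_midpoint, midpoint_eq_smul_add, smul_eq_mul, invOf_eq_inv]
    ring
  simp only [hval, hmid, smul_eq_mul]
  rw [hT, integral_const_mul,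
    measurePreserving_planeEquiv.setIntegral_preimage_emb planeEquiv.measurableEmbedding
    (fun z : ℝ × ℝ => (f (t.vtx 0) + (f (t.vtx 1) - f (t.vtx 0)) * z.1
        + (f (t.vtx 2) - f (t.vtx 0)) * z.2) * (g (t.vtx 0) + (g (t.vtx 1) - g (t.vtx 0)) * z.1
        + (g (t.vtx 2) - g (t.vtx 0)) * z.2)), setIntegral_refTriangle_mul]
  ring

theorem area_eq (t : Tri) : t.area = |t.det| / 2 := by
  have h := t.setIntegral_mul_eq_det (AffineMap.const ℝ E2 1) (AffineMap.const ℝ E2 1)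
  simp [Measure.real] at h
  rw [area, h]
  ring

theorem area_pos (t : Tri) : 0 < t.area := by
  rw [area_eq]
  have := abs_pos.2 t.det_ne_zero
  positivity

/-- The midpoint quadrature rule is exact for products of affine functions. -/
theorem setIntegral_mul (t : Tri) (f g : E2 →ᵃ[ℝ] ℝ) :
    ∫ x in t.carrier, f x * g x = t.area / 3 *
      (f (midpoint ℝ (t.vtx 0) (t.vtx 1)) * g (midpoint ℝ (t.vtx 0) (t.vtx 1))
        + f (midpoint ℝ (t.vtx 0) (t.vtx 2)) * g (midpoint ℝ (t.vtx 0) (t.vtx 2))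
        + f (midpoint ℝ (t.vtx 1) (t.vtx 2)) * g (midpoint ℝ (t.vtx 1) (t.vtx 2))) := by
  rw [setIntegral_mul_eq_det, area_eq]
  ring

end Tri

theorem inner_plane (x y : E2) : ⟪x, y⟫ = x 0 * y 0 + x 1 * y 1 := by
  rw [EuclideanSpace.inner_eq_star_dotProduct]
  simp [dotProduct, Fin.sum_univ_two]
  ring

theorem perp_apply_zero (x : E2) : perp x 0 = -(x 1) := rfl

theorem perp_apply_one (x : E2) : perp x 1 = x 0 := rfl

theorem midpoint_plane_apply (p r : E2) (i : Fin 2) : midpoint ℝ p r i = (p i + r i) / 2 := by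
  rw [midpoint_eq_smul_add]
  simp
  ring

theorem affine_midpoint (f : E2 →ᵃ[ℝ] ℝ) (p r : E2) :
    f (midpoint ℝ p r) = (f p + f r) / 2 := by
  rw [f.map_midpoint, midpoint_eq_smul_add, smul_eq_mul, invOf_eq_inv]
  ring

theorem emid_swap (σ : E2 × E2) : emid σ.swap = emid σ := midpoint_comm ..

namespace Tri

theorem centroid_apply (t : Tri) (i : Fin 2) :
    t.centroid i = (t.vtx 0 i + t.vtx 1 i + t.vtx 2 i) / 3 := by
  have h : t.centroid = (3 : ℝ)⁻¹ • (t.vtx 0 + t.vtx 1 + t.vtx 2) := by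
    rw [centroid, Finset.centroid_def,
      Finset.affineCombination_eq_linear_combination _ _ _
        (Finset.sum_centroidWeights_eq_one_of_nonempty ℝ _ Finset.univ_nonempty)]
    simp [Fin.sum_univ_three, Finset.centroidWeights]
  rw [h]
  simp
  ring

/-- The signed quantity whose sign selects the outward normal of an edge. -/
def orient (t : Tri) (σ : E2 × E2) : ℝ := ⟪perp (σ.2 - σ.1), emid σ - t.centroid⟫

theorem orient_eq (t : Tri) (σ : E2 × E2) : t.orient σ
    = -((σ.2 1 - σ.1 1) * ((σ.1 0 + σ.2 0) / 2 - (t.vtx 0 0 + t.vtx 1 0 + t.vtx 2 0) / 3))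
      + (σ.2 0 - σ.1 0) * ((σ.1 1 + σ.2 1) / 2 - (t.vtx 0 1 + t.vtx 1 1 + t.vtx 2 1) / 3) := by
  rw [orient, inner_plane, perp_apply_zero, perp_apply_one]
  simp only [PiLp.sub_apply, emid, midpoint_plane_apply, centroid_apply]
  ring

theorem orient_swap (t : Tri) (σ : E2 × E2) : t.orient σ.swap = - t.orient σ := by
  rw [orient_eq, orient_eq]
  simp only [Prod.fst_swap, Prod.snd_swap]
  ring

theorem orient_ne_zero (t : Tri) {σ : E2 × E2} (h : t.hasEdge σ) : t.orient σ ≠ 0 := by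
  have hd := t.det_ne_zero
  obtain ⟨a, b⟩ := σ
  obtain ⟨hne, ⟨i, hi⟩, ⟨j, hj⟩⟩ := h
  simp only at hne hi hj
  subst hi hj
  intro h0
  apply hd
  rw [orient_eq] at h0
  rw [det]
  fin_cases i <;> fin_cases j <;> simp only [Fin.zero_eta, Fin.mk_one, Fin.reduceFinMk] at h0 hne
  all_goals first
    | exact absurd rfl hne
    | linear_combination 3 * h0
    | linear_combination -3 * h0

theorem elen_pos {t : Tri} {σ : E2 × E2} (h : t.hasEdge σ) : 0 < elen σ := dist_pos.2 h.1

theorem elen_smul_nrm {t : Tri} {σ : E2 × E2} (h : t.hasEdge σ) :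
    elen σ • t.nrm σ = (SignType.sign (t.orient σ) : ℝ) • perp (σ.2 - σ.1) := by
  have hl := (elen_pos h).ne'
  have ho := t.orient_ne_zero h
  have hdef : t.nrm σ = if 0 ≤ t.orient σ then (elen σ)⁻¹ • perp (σ.2 - σ.1)
    else -((elen σ)⁻¹ • perp (σ.2 - σ.1)) := rfl
  rw [hdef]
  split_ifs with hc
  · rw [sign_pos (lt_of_le_of_ne hc ho.symm), smul_smul, mul_inv_cancel₀ hl, one_smul]
    simp
  · rw [sign_neg (not_le.1 hc), smul_neg, smul_smul, mul_inv_cancel₀ hl, one_smul]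
    simp

theorem hasEdge_swap {t : Tri} {σ : E2 × E2} (h : t.hasEdge σ) : t.hasEdge σ.swap :=
  ⟨h.1.symm, h.2.2, h.2.1⟩

theorem hasEdge_vtx (t : Tri) {i j : Fin 3} (h : i ≠ j) : t.hasEdge (t.vtx i, t.vtx j) :=
  ⟨fun he => h (t.indep.injective he), ⟨i, rfl⟩, ⟨j, rfl⟩⟩

theorem perp_neg (x : E2) : perp (-x) = - perp x := by
  ext i; fin_cases i <;> simp [perp]

theorem elen_smul_nrm_swap {t : Tri} {σ : E2 × E2} (h : t.hasEdge σ) :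
    elen σ.swap • t.nrm σ.swap = elen σ • t.nrm σ := by
  rw [elen_smul_nrm h, elen_smul_nrm (hasEdge_swap h), orient_swap, Left.sign_neg]
  simp only [Prod.fst_swap, Prod.snd_swap]
  rw [← neg_sub σ.2 σ.1, perp_neg]
  rcases lt_or_gt_of_ne (t.orient_ne_zero h) with ho | ho
  · rw [sign_neg ho]; simp
  · rw [sign_pos ho]; simp

/-- The midpoint formula for the gradient of an affine function on a triangle. -/
theorem area_mul_inner_gradA (t : Tri) (f : E2 →ᵃ[ℝ] ℝ) (v : E2) :
    t.area * ⟪v, gradA f⟫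
      = f (emid (t.vtx 0, t.vtx 1)) *
          ⟪v, elen (t.vtx 0, t.vtx 1) • t.nrm (t.vtx 0, t.vtx 1)⟫
        + f (emid (t.vtx 0, t.vtx 2)) *
          ⟪v, elen (t.vtx 0, t.vtx 2) • t.nrm (t.vtx 0, t.vtx 2)⟫
        + f (emid (t.vtx 1, t.vtx 2)) *
          ⟪v, elen (t.vtx 1, t.vtx 2) • t.nrm (t.vtx 1, t.vtx 2)⟫ := by
  have h01 : t.orient (t.vtx 0, t.vtx 1) = -(t.det / 3) := by
    rw [orient_eq, det]; ring
  have h02 : t.orient (t.vtx 0, t.vtx 2) = t.det / 3 := by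
    rw [orient_eq, det]; ring
  have h12 : t.orient (t.vtx 1, t.vtx 2) = -(t.det / 3) := by
    rw [orient_eq, det]; ring
  rw [elen_smul_nrm (t.hasEdge_vtx (by decide)), elen_smul_nrm (t.hasEdge_vtx (by decide)),
    elen_smul_nrm (t.hasEdge_vtx (by decide)), h01, h02, h12, area_eq]
  simp only [emid, affine_midpoint]
  rw [affine_apply_eq f (t.vtx 0), affine_apply_eq f (t.vtx 1), affine_apply_eq f (t.vtx 2)]
  rcases lt_or_gt_of_ne t.det_ne_zero with hd | hd
  · have hp : 0 < -(t.det / 3) := by linarith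
    have hn : t.det / 3 < 0 := by linarith
    rw [sign_pos hp, sign_neg hn, abs_of_neg hd]
    simp only [SignType.coe_one, one_smul, SignType.coe_neg, neg_smul]
    simp only [inner_plane, PiLp.neg_apply, PiLp.sub_apply, perp_apply_zero, perp_apply_one]
    unfold det
    ring
  · have hp : 0 < t.det / 3 := by linarith
    have hn : -(t.det / 3) < 0 := by linarith
    rw [sign_pos hp, sign_neg hn, abs_of_pos hd]
    simp only [SignType.coe_one, one_smul, SignType.coe_neg, neg_smul]
    simp only [inner_plane, PiLp.neg_apply, PiLp.sub_apply, perp_apply_zero, perp_apply_one]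
    unfold det
    ring

theorem interior_carrier (t : Tri) : interior t.carrier = {x | ∀ i, 0 < t.basis.coord i x} := by
  rw [carrier_eq, t.basis.interior_convexHull]

theorem exists_perm_of_hasEdge {t : Tri} {σ : E2 × E2} (h : t.hasEdge σ) :
    ∃ e : Equiv.Perm (Fin 3), t.vtx (e 0) = σ.1 ∧ t.vtx (e 1) = σ.2 := by
  obtain ⟨hne, ⟨i, hi⟩, ⟨j, hj⟩⟩ := h
  have hij : i ≠ j := by
    rintro rfl
    exact hne (hi.symm.trans hj)
  have : ∃ e : Equiv.Perm (Fin 3), e 0 = i ∧ e 1 = j := by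
    clear hi hj
    revert i j
    decide
  obtain ⟨e, rfl, rfl⟩ := this
  exact ⟨e, hi, hj⟩

theorem orient_perm (t : Tri) (e : Equiv.Perm (Fin 3)) :
    t.orient (t.vtx (e 0), t.vtx (e 1))
      = -(1 / 3) * ⟪perp (t.vtx (e 1) - t.vtx (e 0)), t.vtx (e 2) - t.vtx (e 0)⟫ := by
  have hsum : ∀ i, t.vtx 0 i + t.vtx 1 i + t.vtx 2 i
      = t.vtx (e 0) i + t.vtx (e 1) i + t.vtx (e 2) i := by
    intro i
    have := Equiv.sum_comp e (fun k => t.vtx k i)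
    rw [Fin.sum_univ_three, Fin.sum_univ_three] at this
    exact this.symm
  rw [orient_eq, hsum, hsum, inner_plane, perp_apply_zero, perp_apply_one]
  simp only [PiLp.sub_apply]
  ring

theorem inner_perp_eq_coord (t : Tri) (e : Equiv.Perm (Fin 3)) (p : E2) :
    ⟪perp (t.vtx (e 1) - t.vtx (e 0)), p - t.vtx (e 0)⟫
      = t.basis.coord (e 2) p
        * ⟪perp (t.vtx (e 1) - t.vtx (e 0)), t.vtx (e 2) - t.vtx (e 0)⟫ := by
  have hs := t.basis.sum_coord_apply_eq_one p
  have hp := t.basis.linear_combination_coord_eq_self p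
  rw [← Equiv.sum_comp e, Fin.sum_univ_three] at hs hp
  simp only [coe_basis] at hp
  have h0 := congrArg (fun v : E2 => v 0) hp
  have h1 := congrArg (fun v : E2 => v 1) hp
  simp only [PiLp.add_apply, PiLp.smul_apply, smul_eq_mul] at h0 h1
  simp only [inner_plane, perp_apply_zero, perp_apply_one, PiLp.sub_apply]
  rw [← h0, ← h1]
  have hs' : t.basis.coord (e 0) p = 1 - t.basis.coord (e 1) p - t.basis.coord (e 2) p := by
    linarith
  rw [hs']
  ring

/-- Two triangles with a common edge and disjoint interiors lie on opposite sides of it. -/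
theorem orient_mul_neg {s t : Tri} {σ : E2 × E2} (hs : s.hasEdge σ) (ht : t.hasEdge σ)
    (hdisj : interior s.carrier ∩ interior t.carrier = ∅) : s.orient σ * t.orient σ < 0 := by
  by_contra hcon
  have hpos : 0 < s.orient σ * t.orient σ :=
    lt_of_le_of_ne (not_lt.1 hcon) (mul_ne_zero (s.orient_ne_zero hs) (t.orient_ne_zero ht)).symm
  obtain ⟨e, he0, he1⟩ := exists_perm_of_hasEdge hs
  obtain ⟨e', he0', he1'⟩ := exists_perm_of_hasEdge ht
  obtain ⟨a, b⟩ := σ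
  simp only at he0 he1 he0' he1'
  have hos := s.orient_perm e
  have hot := t.orient_perm e'
  have hc := s.inner_perp_eq_coord e (t.vtx (e' 2))
  rw [he0, he1] at hos hc
  rw [he0', he1'] at hot
  have hγ : 0 < s.basis.coord (e 2) (t.vtx (e' 2)) := by
    rw [hc] at hot
    have : s.orient (a, b) * t.orient (a, b)
        = s.basis.coord (e 2) (t.vtx (e' 2)) * (s.orient (a, b)) ^ 2 := by
      rw [hot]
      rw [hos]
      ring
    rw [this] at hpos
    exact pos_of_mul_pos_left hpos (sq_nonneg _)
  set c := t.vtx (e' 2) with hcdef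
  have hline : ∀ (r : Tri) (k : Fin 3) (θ : ℝ),
      r.basis.coord k (AffineMap.lineMap (midpoint ℝ a b) c θ)
        = (1 - θ) * ((r.basis.coord k a + r.basis.coord k b) / 2) + θ * r.basis.coord k c := by
    intro r k θ
    rw [AffineMap.apply_lineMap, affine_midpoint, AffineMap.lineMap_apply]
    simp
    ring
  have hcs : ∀ i j, s.basis.coord i (s.vtx j) = if i = j then 1 else 0 := s.basis.coord_apply
  have hct : ∀ i j, t.basis.coord i (t.vtx j) = if i = j then 1 else 0 := t.basis.coord_apply
  have hpert : ∀ x : ℝ, ∃ δ > 0, ∀ θ : ℝ, 0 < θ → θ < δ → 0 < (1 - θ) * (1 / 2) + θ * x := by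
    intro x
    refine ⟨1 / (2 * (1 + |x|)), by positivity, fun θ h0 h1 => ?_⟩
    rw [lt_div_iff₀ (by positivity)] at h1
    have := mul_le_mul_of_nonneg_left (neg_abs_le x) h0.le
    nlinarith
  obtain ⟨δ₀, hδ₀, H₀⟩ := hpert (s.basis.coord (e 0) c)
  obtain ⟨δ₁, hδ₁, H₁⟩ := hpert (s.basis.coord (e 1) c)
  obtain ⟨θ, hθ0, hθ⟩ := exists_between (lt_min (lt_min hδ₀ hδ₁) zero_lt_one)
  have hθ1 : θ < 1 := hθ.trans_le (min_le_right _ _)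
  have hθδ₀ : θ < δ₀ := hθ.trans_le ((min_le_left _ _).trans (min_le_left _ _))
  have hθδ₁ : θ < δ₁ := hθ.trans_le ((min_le_left _ _).trans (min_le_right _ _))
  have hmem : AffineMap.lineMap (midpoint ℝ a b) c θ
      ∈ interior s.carrier ∩ interior t.carrier := by
    rw [interior_carrier, interior_carrier]
    have hforall : ∀ (e : Equiv.Perm (Fin 3)) (P : Fin 3 → Prop),
        P (e 0) → P (e 1) → P (e 2) → ∀ i, P i := by
      intro e P h0 h1 h2 i
      obtain ⟨j, rfl⟩ := e.surjective i
      fin_cases j <;> assumption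
    constructor
    · refine hforall e _ ?_ ?_ ?_ <;> rw [hline, ← he0, ← he1, hcs, hcs]
      · simpa [e.injective.eq_iff] using H₀ θ hθ0 hθδ₀
      · simpa [e.injective.eq_iff] using H₁ θ hθ0 hθδ₁
      · simpa [e.injective.eq_iff] using mul_pos hθ0 hγ
    · refine hforall e' _ ?_ ?_ ?_ <;> rw [hline, ← he0', ← he1', hct, hct, hcdef, hct]
      · simpa [e'.injective.eq_iff] using hθ1
      · simpa [e'.injective.eq_iff] using hθ1
      · simpa [e'.injective.eq_iff] using hθ0
  rw [hdisj] at hmem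
  exact hmem

theorem elen_smul_nrm_eq_neg {s t : Tri} {σ : E2 × E2} (hs : s.hasEdge σ) (ht : t.hasEdge σ)
    (hdisj : interior s.carrier ∩ interior t.carrier = ∅) :
    elen σ • s.nrm σ = -(elen σ • t.nrm σ) := by
  have h := orient_mul_neg hs ht hdisj
  rw [elen_smul_nrm hs, elen_smul_nrm ht]
  rcases mul_neg_iff.1 h with ⟨h1, h2⟩ | ⟨h1, h2⟩
  · rw [sign_pos h1, sign_neg h2]; simp
  · rw [sign_neg h1, sign_pos h2]; simp

end Tri

namespace Tri

theorem exists_vtx_pair {t : Tri} {σ : E2 × E2} (h : t.hasEdge σ) :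
    ∃ i j : Fin 3, i < j ∧ (σ = (t.vtx i, t.vtx j) ∨ σ.swap = (t.vtx i, t.vtx j)) := by
  obtain ⟨a, b⟩ := σ
  obtain ⟨hne, ⟨i, hi⟩, ⟨j, hj⟩⟩ := h
  simp only at hne hi hj
  subst hi hj
  rcases lt_trichotomy i j with hij | rfl | hij
  · exact ⟨i, j, hij, Or.inl rfl⟩
  · exact absurd rfl hne
  · exact ⟨j, i, hij, Or.inr rfl⟩

/-- An affine function with prescribed values at the three edge midpoints. -/
theorem exists_affine_midpoint (t : Tri) (x₀₁ x₀₂ x₁₂ : ℝ) :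
    ∃ f : E2 →ᵃ[ℝ] ℝ, f (midpoint ℝ (t.vtx 0) (t.vtx 1)) = x₀₁ ∧
      f (midpoint ℝ (t.vtx 0) (t.vtx 2)) = x₀₂ ∧ f (midpoint ℝ (t.vtx 1) (t.vtx 2)) = x₁₂ := by
  have hc : ∀ i j, t.basis.coord i (t.vtx j) = if i = j then 1 else 0 := t.basis.coord_apply
  refine ⟨(x₀₁ + x₀₂ - x₁₂) • t.basis.coord 0 + (x₀₁ + x₁₂ - x₀₂) • t.basis.coord 1
    + (x₀₂ + x₁₂ - x₀₁) • t.basis.coord 2, ?_, ?_, ?_⟩ <;>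
  · rw [affine_midpoint]
    simp [hc]
    ring

end Tri

namespace Mesh

variable {Ω : Set E2} (M : Mesh Ω)

theorem card_filter_pos {σ : E2 × E2} (hσ : σ ∈ M.edges) :
    0 < (M.tris.filter fun t => t.hasEdge σ).card :=
  Finset.card_pos.2 ⟨M.Kof σ, Finset.mem_filter.2 (M.Kof_mem σ hσ)⟩

theorem card_filter_eq_one {σ : E2 × E2} (hσ : σ ∈ M.edges)
    (h : ¬(M.tris.filter fun t => t.hasEdge σ).card = 2) :
    (M.tris.filter fun t => t.hasEdge σ).card = 1 := by
  have := M.card_filter_pos hσ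
  have := M.edges_atMostTwo σ hσ
  omega

theorem filter_hasEdge_int {σ : E2 × E2} (hσ : σ ∈ M.intEdges) :
    (M.tris.filter fun t => t.hasEdge σ) = {M.Kof σ, M.Lof σ} := by
  obtain ⟨he, hc⟩ := Finset.mem_filter.1 hσ
  obtain ⟨hL, hLe, hne⟩ := M.Lof_mem σ he hc
  symm
  apply Finset.eq_of_subset_of_card_le
  · intro t ht
    rcases Finset.mem_insert.1 ht with rfl | ht
    · exact Finset.mem_filter.2 (M.Kof_mem σ he)
    · rw [Finset.mem_singleton.1 ht]
      exact Finset.mem_filter.2 ⟨hL, hLe⟩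
  · rw [hc, Finset.card_pair hne.symm]

theorem filter_hasEdge_ext {σ : E2 × E2} (hσ : σ ∈ M.extEdges) :
    (M.tris.filter fun t => t.hasEdge σ) = {M.Kof σ} := by
  obtain ⟨he, hc⟩ := Finset.mem_filter.1 hσ
  obtain ⟨t, ht⟩ := Finset.card_eq_one.1 hc
  have : M.Kof σ ∈ M.tris.filter fun t => t.hasEdge σ := Finset.mem_filter.2 (M.Kof_mem σ he)
  rw [ht, Finset.mem_singleton] at this
  rw [ht, this]

theorem sum_edges_eq {A : Type*} [AddCommMonoid A] (F : E2 × E2 → A) :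
    ∑ σ ∈ M.edges, F σ = ∑ σ ∈ M.intEdges, F σ + ∑ σ ∈ M.extEdges, F σ := by
  have : M.extEdges
      = M.edges.filter fun σ => ¬(M.tris.filter fun t => t.hasEdge σ).card = 2 := by
    refine Finset.filter_congr fun σ hσ => ⟨fun h => by omega, M.card_filter_eq_one hσ⟩
  rw [this, intEdges, Finset.sum_filter_add_sum_filter_not]

/-- Summation over triangles and their edges, regrouped edge by edge. -/
theorem sum_tris_edges (F : Tri → E2 × E2 → ℝ) :
    ∑ t ∈ M.tris, ∑ σ ∈ M.edges.filter (fun σ => t.hasEdge σ), F t σ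
      = ∑ σ ∈ M.intEdges, (F (M.Kof σ) σ + F (M.Lof σ) σ)
        + ∑ σ ∈ M.extEdges, F (M.Kof σ) σ := by
  have : ∑ t ∈ M.tris, ∑ σ ∈ M.edges.filter (fun σ => t.hasEdge σ), F t σ
      = ∑ σ ∈ M.edges, ∑ t ∈ M.tris.filter (fun t => t.hasEdge σ), F t σ := by
    simp only [Finset.sum_filter]
    exact Finset.sum_comm
  rw [this, sum_edges_eq]
  congr 1
  · refine Finset.sum_congr rfl fun σ hσ => ?_
    obtain ⟨he, hc⟩ := Finset.mem_filter.1 hσ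
    rw [M.filter_hasEdge_int hσ, Finset.sum_pair (M.Lof_mem σ he hc).2.2.symm]
  · refine Finset.sum_congr rfl fun σ hσ => ?_
    rw [M.filter_hasEdge_ext hσ, Finset.sum_singleton]

/-- The recorded orientation of a geometric edge. -/
def recorded (σ : E2 × E2) : E2 × E2 := if σ ∈ M.edges then σ else σ.swap

theorem recorded_of_mem {σ : E2 × E2} (hσ : σ ∈ M.edges) : M.recorded σ = σ := if_pos hσ

theorem recorded_swap_of_mem {σ : E2 × E2} (hσ : σ ∈ M.edges) : M.recorded σ.swap = σ := by
  rw [recorded, if_neg (M.edges_orient σ hσ), Prod.swap_swap]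

theorem recorded_eq_or (σ : E2 × E2) : M.recorded σ = σ ∨ M.recorded σ = σ.swap := by
  rw [recorded]
  split_ifs
  · exact Or.inl rfl
  · exact Or.inr rfl

theorem recorded_vtx_mem {t : Tri} (ht : t ∈ M.tris) {i j : Fin 3} (hij : i ≠ j) :
    M.recorded (t.vtx i, t.vtx j) ∈ M.edges.filter (fun σ => t.hasEdge σ) := by
  rw [recorded]
  split_ifs with h
  · exact Finset.mem_filter.2 ⟨h, t.hasEdge_vtx hij⟩
  · exact Finset.mem_filter.2 ⟨(M.edges_cover t ht i j hij).resolve_left h,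
      t.hasEdge_vtx hij.symm⟩

theorem recorded_vtx_injective (t : Tri) {i j k l : Fin 3}
    (h : M.recorded (t.vtx i, t.vtx j) = M.recorded (t.vtx k, t.vtx l)) :
    (i = k ∧ j = l) ∨ (i = l ∧ j = k) := by
  have inj := t.indep.injective
  rcases M.recorded_eq_or (t.vtx i, t.vtx j) with h1 | h1 <;>
  rcases M.recorded_eq_or (t.vtx k, t.vtx l) with h2 | h2 <;>
  · rw [h1, h2] at h
    simp only [Prod.swap_prod_mk, Prod.mk.injEq, inj.eq_iff] at h
    tauto

theorem filter_edges_eq {t : Tri} (ht : t ∈ M.tris) :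
    M.edges.filter (fun σ => t.hasEdge σ) = {M.recorded (t.vtx 0, t.vtx 1),
      M.recorded (t.vtx 0, t.vtx 2), M.recorded (t.vtx 1, t.vtx 2)} := by
  ext σ
  constructor
  · intro hσ
    obtain ⟨he, hs⟩ := Finset.mem_filter.1 hσ
    obtain ⟨i, j, hij, h⟩ := Tri.exists_vtx_pair hs
    have hr : σ = M.recorded (t.vtx i, t.vtx j) := by
      rcases h with h | h
      · rw [← h, M.recorded_of_mem he]
      · rw [← h, M.recorded_swap_of_mem he]
    rw [hr]
    simp only [Finset.mem_insert, Finset.mem_singleton]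
    fin_cases i <;> fin_cases j <;> simp at hij ⊢
  · intro hσ
    simp only [Finset.mem_insert, Finset.mem_singleton] at hσ
    rcases hσ with rfl | rfl | rfl <;> exact M.recorded_vtx_mem ht (by decide)

/-- Summation over the three edges of a triangle of an orientation-independent quantity. -/
theorem sum_filter_edges {t : Tri} (ht : t ∈ M.tris) (F : E2 × E2 → ℝ)
    (hF : ∀ σ, t.hasEdge σ → F σ.swap = F σ) :
    ∑ σ ∈ M.edges.filter (fun σ => t.hasEdge σ), F σ
      = F (t.vtx 0, t.vtx 1) + F (t.vtx 0, t.vtx 2) + F (t.vtx 1, t.vtx 2) := by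
  have hne : ∀ i j k l : Fin 3, ¬((i = k ∧ j = l) ∨ (i = l ∧ j = k)) →
      M.recorded (t.vtx i, t.vtx j) ≠ M.recorded (t.vtx k, t.vtx l) :=
    fun i j k l h he => h (M.recorded_vtx_injective t he)
  have hval : ∀ i j : Fin 3, i ≠ j →
      F (M.recorded (t.vtx i, t.vtx j)) = F (t.vtx i, t.vtx j) := by
    intro i j hij
    rcases M.recorded_eq_or (t.vtx i, t.vtx j) with h | h <;> rw [h]
    exact hF _ (t.hasEdge_vtx hij)
  rw [M.filter_edges_eq ht, Finset.sum_insert, Finset.sum_pair, hval _ _ (by decide),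
    hval _ _ (by decide), hval _ _ (by decide), add_assoc]
  · exact hne _ _ _ _ (by decide)
  · simp only [Finset.mem_insert, Finset.mem_singleton, not_or]
    exact ⟨hne _ _ _ _ (by decide), hne _ _ _ _ (by decide)⟩

theorem exists_affine_emid (F : E2 × E2 → ℝ) (t : Tri) :
    ∃ f : E2 →ᵃ[ℝ] ℝ, ∀ σ ∈ M.edges, t.hasEdge σ → f (emid σ) = F σ := by
  obtain ⟨f, h01, h02, h12⟩ := t.exists_affine_midpoint (F (M.recorded (t.vtx 0, t.vtx 1)))
    (F (M.recorded (t.vtx 0, t.vtx 2))) (F (M.recorded (t.vtx 1, t.vtx 2)))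
  refine ⟨f, fun σ hσ hs => ?_⟩
  obtain ⟨i, j, hij, h⟩ := Tri.exists_vtx_pair hs
  have hr : M.recorded (t.vtx i, t.vtx j) = σ := by
    rcases h with h | h
    · rw [← h, M.recorded_of_mem hσ]
    · rw [← h, M.recorded_swap_of_mem hσ]
  have hm : emid σ = midpoint ℝ (t.vtx i) (t.vtx j) := by
    rcases h with h | h
    · rw [h]; rfl
    · rw [← emid_swap, h]; rfl
  rw [hm, ← hr]
  fin_cases i <;> fin_cases j <;> simp at hij <;> assumption

theorem exists_isDivh (v : Tri → E2) : ∃ d, M.IsDivh v d := by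
  choose d hd using M.exists_affine_emid (M.divhImage v)
  refine ⟨d, fun σ hσ => ?_, fun t _ => hd t⟩
  obtain ⟨he, hc⟩ := Finset.mem_filter.1 hσ
  rw [hd _ σ he (M.Kof_mem σ he).2, hd _ σ he (M.Lof_mem σ he hc).2.1]

theorem setIntegral_mul_eq_sum_edges {t : Tri} (ht : t ∈ M.tris) (f g : E2 →ᵃ[ℝ] ℝ) :
    ∫ x in t.carrier, f x * g x = ∑ σ ∈ M.edges.filter (fun σ => t.hasEdge σ),
      t.area / 3 * (f (emid σ) * g (emid σ)) := by
  rw [M.sum_filter_edges ht _ (fun σ _ => by rw [emid_swap]), t.setIntegral_mul]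
  simp only [emid]
  ring

theorem area_mul_inner_eq_sum_edges {t : Tri} (ht : t ∈ M.tris) (f : E2 →ᵃ[ℝ] ℝ) (v : E2) :
    t.area * ⟪v, gradA f⟫ = ∑ σ ∈ M.edges.filter (fun σ => t.hasEdge σ),
      f (emid σ) * ⟪v, elen σ • t.nrm σ⟫ := by
  rw [M.sum_filter_edges ht _ (fun σ h => by rw [emid_swap, Tri.elen_smul_nrm_swap h]),
    t.area_mul_inner_gradA]

/-- The discrete divergence is minus the adjoint of the discrete gradient. -/
theorem l2P1_isDivh {q d : Tri → (E2 →ᵃ[ℝ] ℝ)} {v : Tri → E2} (hq : M.IsP1nc q)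
    (hd : M.IsDivh v d) : M.l2P1 q d = -(M.l2P0 v (gradh q)) := by
  have h1 : M.l2P1 q d = ∑ t ∈ M.tris, ∑ σ ∈ M.edges.filter (fun σ => t.hasEdge σ),
      t.area / 3 * (q t (emid σ) * d t (emid σ)) :=
    Finset.sum_congr rfl fun t ht => M.setIntegral_mul_eq_sum_edges ht _ _
  have h2 : M.l2P0 v (gradh q) = ∑ t ∈ M.tris, ∑ σ ∈ M.edges.filter (fun σ => t.hasEdge σ),
      q t (emid σ) * ⟪v t, elen σ • t.nrm σ⟫ :=
    Finset.sum_congr rfl fun t ht => M.area_mul_inner_eq_sum_edges ht _ _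
  rw [h1, h2, sum_tris_edges, sum_tris_edges, neg_add, ← Finset.sum_neg_distrib,
    ← Finset.sum_neg_distrib]
  congr 1
  · refine Finset.sum_congr rfl fun σ hσ => ?_
    obtain ⟨he, hc⟩ := Finset.mem_filter.1 hσ
    obtain ⟨hK, hKe⟩ := M.Kof_mem σ he
    obtain ⟨hL, hLe, hne⟩ := M.Lof_mem σ he hc
    rw [hd.2 _ hK σ he hKe, hd.2 _ hL σ he hLe, hq σ hσ, divhImage, if_pos hc,
      Tri.elen_smul_nrm_eq_neg hLe hKe (M.interior_disjoint _ hL _ hK hne),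
      inner_neg_right, inner_smul_right, inner_smul_right, inner_sub_left]
    have := (M.Kof σ).area_pos
    have := (M.Lof σ).area_pos
    field_simp
    ring
  · refine Finset.sum_congr rfl fun σ hσ => ?_
    obtain ⟨he, hc⟩ := Finset.mem_filter.1 hσ
    obtain ⟨hK, hKe⟩ := M.Kof_mem σ he
    rw [hd.2 _ hK σ he hKe, divhImage, if_neg (by omega), inner_smul_right]
    have := (M.Kof σ).area_pos
    field_simp

end Mesh

namespace Tri

theorem dist_ccenter (t : Tri) (i : Fin 3) :
    dist (t.vtx i) t.ccenter = t.simplex.circumradius :=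
  t.simplex.dist_circumcenter_eq_circumradius i

theorem carrier_subset_closedBall (t : Tri) :
    t.carrier ⊆ Metric.closedBall t.ccenter t.simplex.circumradius := by
  refine convexHull_min ?_ (convex_closedBall _ _)
  rintro _ ⟨i, rfl⟩
  exact (t.dist_ccenter i).le

theorem dist_le_of_mem_carrier {t : Tri} {x y : E2} (hx : x ∈ t.carrier) (hy : y ∈ t.carrier) :
    dist x y ≤ 2 * t.simplex.circumradius := by
  have h1 : dist x t.ccenter ≤ _ := t.carrier_subset_closedBall hx
  have h2 : dist y t.ccenter ≤ _ := t.carrier_subset_closedBall hy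
  have := dist_triangle_right x y t.ccenter
  linarith

theorem circumradius_pos (t : Tri) : 0 < t.simplex.circumradius :=
  t.simplex.circumradius_pos

theorem dist_sq_plane (x y : E2) : dist x y ^ 2 = (x 0 - y 0) ^ 2 + (x 1 - y 1) ^ 2 := by
  rw [EuclideanSpace.dist_eq, Real.sq_sqrt (by positivity), Fin.sum_univ_two, Real.dist_eq,
    Real.dist_eq, sq_abs, sq_abs]

/-- The product of the side lengths is four times the circumradius times the area. -/
theorem circumradius_det (t : Tri) :
    4 * t.simplex.circumradius ^ 2 * t.det ^ 2
      = dist (t.vtx 0) (t.vtx 1) ^ 2 * dist (t.vtx 0) (t.vtx 2) ^ 2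
        * dist (t.vtx 1) (t.vtx 2) ^ 2 := by
  have h0 := congrArg (· ^ 2) (t.dist_ccenter 0)
  have h1 := congrArg (· ^ 2) (t.dist_ccenter 1)
  have h2 := congrArg (· ^ 2) (t.dist_ccenter 2)
  simp only [dist_sq_plane] at h0 h1 h2 ⊢
  rw [det]
  generalize t.simplex.circumradius = R at *
  generalize t.ccenter 0 = o0 at *
  generalize t.ccenter 1 = o1 at *
  generalize t.vtx 0 0 = a0 at *
  generalize t.vtx 0 1 = a1 at *
  generalize t.vtx 1 0 = b0 at *
  generalize t.vtx 1 1 = b1 at *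
  generalize t.vtx 2 0 = c0 at *
  generalize t.vtx 2 1 = c1 at *
  obtain ⟨u0, rfl⟩ : ∃ u, b0 = a0 + u := ⟨b0 - a0, by ring⟩
  obtain ⟨u1, rfl⟩ : ∃ u, b1 = a1 + u := ⟨b1 - a1, by ring⟩
  obtain ⟨w0, rfl⟩ : ∃ u, c0 = a0 + u := ⟨c0 - a0, by ring⟩
  obtain ⟨w1, rfl⟩ : ∃ u, c1 = a1 + u := ⟨c1 - a1, by ring⟩
  obtain ⟨p0, rfl⟩ : ∃ u, o0 = a0 + u := ⟨o0 - a0, by ring⟩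
  obtain ⟨p1, rfl⟩ : ∃ u, o1 = a1 + u := ⟨o1 - a1, by ring⟩
  have hu : 2 * (u0 * p0 + u1 * p1) = u0 ^ 2 + u1 ^ 2 := by linear_combination h0 - h1
  have hw : 2 * (w0 * p0 + w1 * p1) = w0 ^ 2 + w1 ^ 2 := by linear_combination h0 - h2
  have e0 : 2 * (u0 * w1 - u1 * w0) * p0 = (u0 ^ 2 + u1 ^ 2) * w1 - (w0 ^ 2 + w1 ^ 2) * u1 := by
    rw [← hu, ← hw]; ring
  have e1 : 2 * (u0 * w1 - u1 * w0) * p1 = (w0 ^ 2 + w1 ^ 2) * u0 - (u0 ^ 2 + u1 ^ 2) * w0 := by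
    rw [← hu, ← hw]; ring
  have hR : R ^ 2 = p0 ^ 2 + p1 ^ 2 := by linear_combination -h0
  have : 4 * R ^ 2 * (u0 * w1 - u1 * w0) ^ 2 = (2 * (u0 * w1 - u1 * w0) * p0) ^ 2
      + (2 * (u0 * w1 - u1 * w0) * p1) ^ 2 := by rw [hR]; ring
  rw [e0, e1] at this
  linear_combination this

end Tri

namespace Mesh

variable {Ω : Set E2} (M : Mesh Ω)

theorem two_circumradius_le {t : Tri} (ht : t ∈ M.tris) :
    2 * t.simplex.circumradius ≤ M.meshSize :=
  Finset.le_sup' (fun t : Tri => 2 * t.simplex.circumradius) ht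

theorem meshSize_pos : 0 < M.meshSize := by
  obtain ⟨t, ht⟩ := M.tris_nonempty
  have := M.two_circumradius_le ht
  have := t.circumradius_pos
  linarith

theorem dist_le_meshSize {t : Tri} (ht : t ∈ M.tris) {x y : E2} (hx : x ∈ t.carrier)
    (hy : y ∈ t.carrier) : dist x y ≤ M.meshSize :=
  (Tri.dist_le_of_mem_carrier hx hy).trans (M.two_circumradius_le ht)

variable {M} {Creg : ℝ}

theorem Regular.le_dist (hM : M.Regular Creg) {t : Tri} (ht : t ∈ M.tris) {i j : Fin 3}
    (hij : i ≠ j) : Creg * M.meshSize ≤ dist (t.vtx i) (t.vtx j) := by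
  rcases M.edges_cover t ht i j hij with h | h
  · exact (hM _ h).2
  · rw [dist_comm]; exact (hM _ h).2

theorem Regular.area_ge (hC : 0 < Creg) (hM : M.Regular Creg) {t : Tri} (ht : t ∈ M.tris) :
    Creg ^ 3 / 2 * M.meshSize ^ 2 ≤ t.area := by
  have hh := M.meshSize_pos
  have hR := M.two_circumradius_le ht
  have hR0 := t.circumradius_pos
  have hCh : 0 < Creg * M.meshSize := mul_pos hC hh
  have key : (Creg ^ 3 * M.meshSize ^ 2) ^ 2 ≤ t.det ^ 2 := by
    have h1 := t.circumradius_det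
    have h2 : (Creg * M.meshSize) ^ 2 * (Creg * M.meshSize) ^ 2 * (Creg * M.meshSize) ^ 2
        ≤ dist (t.vtx 0) (t.vtx 1) ^ 2 * dist (t.vtx 0) (t.vtx 2) ^ 2
        * dist (t.vtx 1) (t.vtx 2) ^ 2 := by
      gcongr <;> exact hM.le_dist ht (by decide)
    have h3 : 4 * t.simplex.circumradius ^ 2 * t.det ^ 2 ≤ M.meshSize ^ 2 * t.det ^ 2 := by
      have : 4 * t.simplex.circumradius ^ 2 ≤ M.meshSize ^ 2 := by nlinarith
      gcongr
    have h4 : M.meshSize ^ 2 * (Creg ^ 3 * M.meshSize ^ 2) ^ 2 ≤ M.meshSize ^ 2 * t.det ^ 2 := by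
      calc _ = (Creg * M.meshSize) ^ 2 * (Creg * M.meshSize) ^ 2 * (Creg * M.meshSize) ^ 2 := by
            ring
        _ ≤ _ := h2.trans (h1 ▸ h3)
    exact le_of_mul_le_mul_left h4 (by positivity)
  have := sq_le_sq.1 key
  rw [abs_of_pos (by positivity)] at this
  rw [Tri.area_eq]
  linarith

theorem sum_filter_edges_const {t : Tri} (ht : t ∈ M.tris) (c : ℝ) :
    ∑ _σ ∈ M.edges.filter (fun σ => t.hasEdge σ), c = 3 * c := by
  rw [M.sum_filter_edges ht (fun _ => c) (fun _ _ => rfl)]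
  ring

theorem Regular.tau_le (hC : 0 < Creg) (hM : M.Regular Creg) {σ : E2 × E2} (hσ : σ ∈ M.edges) :
    M.tau σ ≤ 1 / Creg := by
  have hl : 0 < elen σ := Tri.elen_pos (M.Kof_mem σ hσ).2
  have hd := (hM σ hσ).1
  have hd0 : 0 < M.dOf σ := lt_of_lt_of_le (mul_pos hC hl) hd
  rw [tau, div_le_div_iff₀ hd0 hC]
  linarith

/-- The inverse inequality for the discrete `H¹` norm of piecewise constant fields. -/
theorem Regular.normh_sq_le (hC : 0 < Creg) (hM : M.Regular Creg) (v : Tri → E2) :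
    M.meshSize ^ 2 * M.normh v ^ 2 ≤ 12 / Creg ^ 4 * M.l2P0 v v := by
  have hh := M.meshSize_pos
  have hsum : ∑ σ ∈ M.intEdges, M.tau σ * ‖v (M.Lof σ) - v (M.Kof σ)‖ ^ 2
      + ∑ σ ∈ M.extEdges, M.tau σ * ‖v (M.Kof σ)‖ ^ 2
      ≤ ∑ t ∈ M.tris, ∑ σ ∈ M.edges.filter (fun σ => t.hasEdge σ),
        1 / Creg * (2 * ‖v t‖ ^ 2) := by
    rw [M.sum_tris_edges (fun t _ => 1 / Creg * (2 * ‖v t‖ ^ 2))]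
    refine add_le_add (Finset.sum_le_sum fun σ hσ => ?_) (Finset.sum_le_sum fun σ hσ => ?_)
    · have ht := hM.tau_le hC (Finset.mem_filter.1 hσ).1
      have hn : ‖v (M.Lof σ) - v (M.Kof σ)‖ ^ 2
          ≤ 2 * ‖v (M.Kof σ)‖ ^ 2 + 2 * ‖v (M.Lof σ)‖ ^ 2 := by
        have := norm_sub_le (v (M.Lof σ)) (v (M.Kof σ))
        have := norm_nonneg (v (M.Lof σ) - v (M.Kof σ))
        nlinarith [sq_nonneg (‖v (M.Lof σ)‖ - ‖v (M.Kof σ)‖)]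
      rw [← mul_add]
      exact mul_le_mul ht hn (by positivity) (by positivity)
    · have ht := hM.tau_le hC (Finset.mem_filter.1 hσ).1
      exact mul_le_mul ht (by nlinarith [sq_nonneg ‖v (M.Kof σ)‖]) (by positivity) (by positivity)
  have hbound : M.normh v ^ 2 ≤ ∑ t ∈ M.tris, 3 * (1 / Creg * (2 * ‖v t‖ ^ 2)) := by
    rw [← Finset.sum_congr rfl fun t ht => sum_filter_edges_const ht _]
    rw [normh, ← Real.sqrt_le_sqrt_iff (by positivity)] at *
    · rwa [Real.sqrt_sq (Real.sqrt_nonneg _)]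
  calc M.meshSize ^ 2 * M.normh v ^ 2
      ≤ M.meshSize ^ 2 * ∑ t ∈ M.tris, 3 * (1 / Creg * (2 * ‖v t‖ ^ 2)) := by gcongr
    _ = ∑ t ∈ M.tris, 12 / Creg ^ 4 * ((Creg ^ 3 / 2 * M.meshSize ^ 2) * ‖v t‖ ^ 2) := by
        rw [Finset.mul_sum]
        refine Finset.sum_congr rfl fun t _ => ?_
        field_simp
        ring
    _ ≤ ∑ t ∈ M.tris, 12 / Creg ^ 4 * (t.area * ‖v t‖ ^ 2) := by
        refine Finset.sum_le_sum fun t ht => ?_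
        have := hM.area_ge hC ht
        gcongr
    _ = _ := by
        rw [l2P0, Finset.mul_sum]
        simp only [real_inner_self_eq_norm_sq]

end Mesh

namespace Tri

theorem centroid_mem_carrier (t : Tri) : t.centroid ∈ t.carrier := by
  have h : t.centroid = Finset.univ.centroid ℝ t.basis := rfl
  rw [carrier_eq, t.basis.convexHull_eq_nonneg_coord]
  intro i
  rw [h, AffineBasis.coord_apply_centroid _ (Finset.mem_univ i)]
  positivity

theorem emid_mem_carrier {t : Tri} {σ : E2 × E2} (h : t.hasEdge σ) : emid σ ∈ t.carrier := by
  obtain ⟨-, ⟨i, hi⟩, ⟨j, hj⟩⟩ := h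
  have h1 := t.vtx_mem_carrier i
  have h2 := t.vtx_mem_carrier j
  rw [hi] at h1
  rw [hj] at h2
  exact t.convex_carrier.segment_subset h1 h2 (midpoint_mem_segment _ _)

end Tri

/-- Finitely many closed sets covering a connected set, labelled by intervals of the line that
meet whenever the sets meet, have labels whose union has no gap. -/
theorem abs_sub_le_sum_of_connected {ι E : Type*} [TopologicalSpace E] {s : Set E}
    (hs : IsPreconnected s) (S : Finset ι) (F : ι → Set E) (hF : ∀ i ∈ S, IsClosed (F i))
    (hcov : s ⊆ ⋃ i ∈ S, F i) (u r : ι → ℝ) (hr : ∀ i, 0 ≤ r i)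
    (hmeet : ∀ i ∈ S, ∀ j ∈ S, (s ∩ (F i ∩ F j)).Nonempty → |u i - u j| ≤ r i + r j)
    {a b : ι} (ha : a ∈ S) (hb : b ∈ S) (has : (s ∩ F a).Nonempty) (hbs : (s ∩ F b).Nonempty) :
    |u a - u b| ≤ ∑ i ∈ S, 2 * r i := by
  wlog hab : u a ≤ u b generalizing a b
  · rw [abs_sub_comm]
    exact this hb ha hbs has (le_of_not_ge hab)
  have hsub : Set.Icc (u a) (u b) ⊆ ⋃ i ∈ S, Set.Icc (u i - r i) (u i + r i) := by
    intro c hc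
    by_contra hcon
    simp only [Set.mem_iUnion, Set.mem_Icc, not_exists, not_and, not_le] at hcon
    have hlow : ∀ i ∈ S, u i ≤ c → u i + r i < c := fun i hi h =>
      hcon i hi (by linarith [hr i])
    have hup : ∀ i ∈ S, c < u i → c < u i - r i := fun i hi h => by
      by_contra h'
      exact absurd (hcon i hi (not_lt.1 h')) (by linarith [hr i])
    have hbc : c < u b := by
      rcases hc.2.lt_or_eq with h | h
      · exact h
      · exact absurd (hlow b hb h.ge) (by linarith [hr b])
    have := (isPreconnected_closed_iff.1 hs)
      (⋃ i ∈ S.filter (fun i => u i ≤ c), F i) (⋃ i ∈ S.filter (fun i => c < u i), F i)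
      ((Finset.finite_toSet _).isClosed_biUnion fun i hi => hF i (Finset.mem_filter.1 hi).1)
      ((Finset.finite_toSet _).isClosed_biUnion fun i hi => hF i (Finset.mem_filter.1 hi).1)
      (by
        intro x hx
        obtain ⟨i, hi, hxi⟩ := Set.mem_iUnion₂.1 (hcov hx)
        rcases le_or_gt (u i) c with h | h
        · exact Or.inl (Set.mem_iUnion₂.2 ⟨i, Finset.mem_filter.2 ⟨hi, h⟩, hxi⟩)
        · exact Or.inr (Set.mem_iUnion₂.2 ⟨i, Finset.mem_filter.2 ⟨hi, h⟩, hxi⟩))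
      (by
        obtain ⟨x, hx, hxa⟩ := has
        exact ⟨x, hx, Set.mem_iUnion₂.2 ⟨a, Finset.mem_filter.2 ⟨ha, hc.1⟩, hxa⟩⟩)
      (by
        obtain ⟨x, hx, hxb⟩ := hbs
        exact ⟨x, hx, Set.mem_iUnion₂.2 ⟨b, Finset.mem_filter.2 ⟨hb, hbc⟩, hxb⟩⟩)
    obtain ⟨x, hx, hx1, hx2⟩ := this
    obtain ⟨i, hi, hxi⟩ := Set.mem_iUnion₂.1 hx1
    obtain ⟨j, hj, hxj⟩ := Set.mem_iUnion₂.1 hx2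
    obtain ⟨hi, hic⟩ := Finset.mem_filter.1 hi
    obtain ⟨hj, hjc⟩ := Finset.mem_filter.1 hj
    have h1 := (abs_le.1 (hmeet i hi j hj ⟨x, hx, hxi, hxj⟩)).1
    have h2 := hlow i hi hic
    have h3 := hup j hj hjc
    linarith
  have hvol := (measure_mono (μ := volume) hsub).trans (measure_biUnion_finset_le S _)
  simp only [Real.volume_Icc] at hvol
  rw [← ENNReal.ofReal_sum_of_nonneg (fun i _ => by linarith [hr i]),
    ENNReal.ofReal_le_ofReal_iff (Finset.sum_nonneg fun i _ => by linarith [hr i])] at hvol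
  rw [abs_sub_comm, abs_of_nonneg (by linarith)]
  refine hvol.trans (Finset.sum_le_sum fun i _ => ?_)
  linarith

namespace Mesh

variable {Ω : Set E2} (M : Mesh Ω)

theorem exists_intEdge {t t' : Tri} (ht : t ∈ M.tris) (ht' : t' ∈ M.tris) (hne : t ≠ t')
    {σ : E2 × E2} (h : t.hasEdge σ) (h' : t'.hasEdge σ) :
    ∃ ρ ∈ M.intEdges, t.hasEdge ρ ∧ t'.hasEdge ρ ∧
      ({t, t'} : Finset Tri) = {M.Kof ρ, M.Lof ρ} := by
  obtain ⟨ρ, hρ, hρt, hρt'⟩ : ∃ ρ ∈ M.edges, t.hasEdge ρ ∧ t'.hasEdge ρ := by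
    obtain ⟨i, j, hij, hσ⟩ := Tri.exists_vtx_pair h
    obtain ⟨he, hte⟩ := Finset.mem_filter.1 (M.recorded_vtx_mem ht hij.ne)
    refine ⟨_, he, hte, ?_⟩
    have hij' : t'.hasEdge (t.vtx i, t.vtx j) := by
      rcases hσ with hσ | hσ
      · exact hσ ▸ h'
      · exact hσ ▸ Tri.hasEdge_swap h'
    rcases M.recorded_eq_or (t.vtx i, t.vtx j) with h1 | h1 <;> rw [h1]
    · exact hij'
    · exact Tri.hasEdge_swap hij'
  have hsub : ({t, t'} : Finset Tri) ⊆ M.tris.filter fun s => s.hasEdge ρ := by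
    intro s hs
    rcases Finset.mem_insert.1 hs with rfl | hs
    · exact Finset.mem_filter.2 ⟨ht, hρt⟩
    · rw [Finset.mem_singleton.1 hs]
      exact Finset.mem_filter.2 ⟨ht', hρt'⟩
  have hcard := M.edges_atMostTwo ρ hρ
  have heq := Finset.eq_of_subset_of_card_le hsub (by rwa [Finset.card_pair hne])
  have hintg : ρ ∈ M.intEdges :=
    Finset.mem_filter.2 ⟨hρ, by rw [← heq, Finset.card_pair hne]⟩
  exact ⟨ρ, hintg, hρt, hρt', heq.trans (M.filter_hasEdge_int hintg)⟩

theorem abs_sub_centroid_le {t : Tri} (ht : t ∈ M.tris) (q : Tri → (E2 →ᵃ[ℝ] ℝ)) {x : E2}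
    (hx : x ∈ t.carrier) :
    |q t x - q t t.centroid| ≤ M.meshSize * ‖gradh q t‖ := by
  rw [affine_sub_eq, mul_comm]
  refine (abs_real_inner_le_norm _ _).trans ?_
  have := M.dist_le_meshSize ht hx t.centroid_mem_carrier
  rw [dist_eq_norm] at this
  exact mul_le_mul_of_nonneg_left this (norm_nonneg _)

theorem abs_centroid_sub_le {q : Tri → (E2 →ᵃ[ℝ] ℝ)} (hq : M.IsP1nc q) {t t' : Tri}
    (ht : t ∈ M.tris) (ht' : t' ∈ M.tris) {x : E2} (hx : x ∈ t.carrier) (hx' : x ∈ t'.carrier)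
    (hxv : ∀ s ∈ M.tris, ∀ i, s.vtx i ≠ x) :
    |q t t.centroid - q t' t'.centroid|
      ≤ M.meshSize * ‖gradh q t‖ + M.meshSize * ‖gradh q t'‖ := by
  have hh := M.meshSize_pos.le
  by_cases hne : t = t'
  · subst hne
    rw [sub_self, abs_zero]
    positivity
  have hmem : x ∈ t.carrier ∩ t'.carrier := ⟨hx, hx'⟩
  rcases M.inter_structure t ht t' ht' hne with h | ⟨a, ⟨⟨i, hi⟩, -⟩, h⟩ | ⟨σ, hσ, hσ', -⟩
  · rw [h] at hmem
    exact absurd hmem (Set.notMem_empty x)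
  · rw [h] at hmem
    exact absurd (hi.trans (Set.mem_singleton_iff.1 hmem).symm) (hxv t ht i)
  · obtain ⟨ρ, hρ, hρt, hρt', heq⟩ := M.exists_intEdge ht ht' hne hσ hσ'
    have hval : q t (emid ρ) = q t' (emid ρ) := by
      have hK := hq ρ hρ
      have h1 : t ∈ ({M.Kof ρ, M.Lof ρ} : Finset Tri) := heq ▸ Finset.mem_insert_self _ _
      have h2 : t' ∈ ({M.Kof ρ, M.Lof ρ} : Finset Tri) := heq ▸ by simp
      simp only [Finset.mem_insert, Finset.mem_singleton] at h1 h2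
      rcases h1 with rfl | rfl <;> rcases h2 with rfl | rfl
      exacts [rfl, hK, hK.symm, rfl]
    have h1 := M.abs_sub_centroid_le ht q (Tri.emid_mem_carrier hρt)
    have h2 := M.abs_sub_centroid_le ht' q (Tri.emid_mem_carrier hρt')
    rw [hval] at h1
    rw [abs_le] at h1 h2 ⊢
    constructor <;> linarith [h1.1, h1.2, h2.1, h2.2]

/-- Along a segment contained in the closed domain and avoiding the vertices of the mesh,
the centroid values of a nonconforming function vary by at most the gradients that are met. -/
theorem abs_centroid_sub_le_of_segment {q : Tri → (E2 →ᵃ[ℝ] ℝ)} (hq : M.IsP1nc q) {t t' : Tri}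
    (ht : t ∈ M.tris) (ht' : t' ∈ M.tris) {x y : E2} (hx : x ∈ t.carrier) (hy : y ∈ t'.carrier)
    (hxy : segment ℝ x y ⊆ closure Ω) (hv : ∀ s ∈ M.tris, ∀ i, s.vtx i ∉ segment ℝ x y) :
    |q t t.centroid - q t' t'.centroid|
      ≤ ∑ s ∈ M.tris.filter (fun s => (segment ℝ x y ∩ s.carrier).Nonempty),
        2 * (M.meshSize * ‖gradh q s‖) := by
  have hh := M.meshSize_pos.le
  have hx' : (segment ℝ x y ∩ t.carrier).Nonempty := ⟨x, left_mem_segment ℝ x y, hx⟩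
  have hy' : (segment ℝ x y ∩ t'.carrier).Nonempty := ⟨y, right_mem_segment ℝ x y, hy⟩
  refine abs_sub_le_sum_of_connected (convex_segment x y).isPreconnected _
    (fun s => s.carrier) (fun s _ => s.isCompact_carrier.isClosed) ?_
    (fun s => q s s.centroid) (fun s => M.meshSize * ‖gradh q s‖)
    (fun s => by positivity) ?_ (Finset.mem_filter.2 ⟨ht, hx'⟩)
    (Finset.mem_filter.2 ⟨ht', hy'⟩) hx' hy'
  · intro z hz
    have := hxy hz
    rw [← M.union_eq] at this
    obtain ⟨s, hs, hzs⟩ := Set.mem_iUnion₂.1 this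
    exact Set.mem_iUnion₂.2 ⟨s, Finset.mem_filter.2 ⟨hs, z, hz, hzs⟩, hzs⟩
  · rintro s hs s' hs' ⟨z, hz, hzs, hzs'⟩
    exact M.abs_centroid_sub_le hq (Finset.mem_filter.1 hs).1 (Finset.mem_filter.1 hs').1 hzs hzs'
      fun r hr i hri => hv r hr i (hri ▸ hz)

end Mesh

/-- An upper bound for the area of the closed `r`-neighbourhood of a segment of length `L`. -/
def tubeArea (L r : ℝ) : ℝ := 4 * Real.pi * ((L + 3 * r) * r)

theorem volume_segment_nhds_le (a b : E2) {L r : ℝ} (hL : dist a b ≤ L) (hr : 0 < r) :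
    volume {x : E2 | ∃ p ∈ segment ℝ a b, dist x p ≤ r} ≤ ENNReal.ofReal (tubeArea L r) := by
  have hL0 : 0 ≤ L := dist_nonneg.trans hL
  set n : ℕ := ⌈L / r⌉₊ + 1 with hn
  have hn0 : (0 : ℝ) < n := by positivity
  have hn1 : L / r ≤ n := (Nat.le_ceil _).trans (by rw [hn]; push_cast; linarith)
  have hn2 : (n : ℝ) ≤ L / r + 2 := by
    rw [hn]; push_cast; linarith [Nat.ceil_lt_add_one (div_nonneg hL0 hr.le)]
  have hcov : {x : E2 | ∃ p ∈ segment ℝ a b, dist x p ≤ r} ⊆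
      ⋃ k ∈ Finset.range (n + 1),
        Metric.closedBall (AffineMap.lineMap a b ((k : ℝ) / n) : E2) (2 * r) := by
    rintro x ⟨p, hp, hxp⟩
    rw [segment_eq_image_lineMap] at hp
    obtain ⟨s, ⟨hs0, hs1⟩, rfl⟩ := hp
    have hk0 := Nat.floor_le (mul_nonneg hs0 hn0.le)
    have hk1 := Nat.lt_floor_add_one (s * n)
    refine Set.mem_iUnion₂.2 ⟨⌊s * n⌋₊, Finset.mem_range.2 (Nat.lt_succ_of_le ?_), ?_⟩
    · refine Nat.floor_le_of_le ?_
      nlinarith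
    · rw [Metric.mem_closedBall]
      refine (dist_triangle x (AffineMap.lineMap a b s) _).trans ?_
      have hd : dist s ((⌊s * n⌋₊ : ℝ) / n) ≤ 1 / n := by
        rw [Real.dist_eq, abs_le, le_sub_iff_add_le, sub_le_iff_le_add, ← add_div, neg_add_eq_sub,
          ← sub_div, div_le_iff₀ hn0, le_div_iff₀ hn0]
        constructor <;> linarith
      have : dist s ((⌊s * n⌋₊ : ℝ) / n) * dist a b ≤ r := by
        calc _ ≤ 1 / n * L := by gcongr
          _ ≤ r := by
            rw [div_mul_eq_mul_div, one_mul, div_le_iff₀ hn0]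
            rw [div_le_iff₀ hr] at hn1
            linarith
      rw [dist_lineMap_lineMap]
      linarith
  refine (measure_mono hcov).trans ((measure_biUnion_finset_le _ _).trans ?_)
  simp only [EuclideanSpace.volume_closedBall_fin_two, Finset.sum_const, Finset.card_range,
    nsmul_eq_mul]
  rw [← ENNReal.ofReal_natCast, ← ENNReal.ofReal_pow (by positivity),
    ← ENNReal.ofReal_mul (by positivity), ← ENNReal.ofReal_mul (by positivity)]
  apply ENNReal.ofReal_le_ofReal
  have h3 : ((n + 1 : ℕ) : ℝ) * r ≤ L + 3 * r := by
    push_cast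
    calc ((n : ℝ) + 1) * r ≤ (L / r + 2 + 1) * r := by gcongr
      _ = L + 3 * r := by field_simp; ring
  rw [tubeArea]
  have hpi := Real.pi_pos
  calc ((n + 1 : ℕ) : ℝ) * ((2 * r) ^ 2 * Real.pi)
      = 4 * Real.pi * ((((n + 1 : ℕ) : ℝ) * r) * r) := by ring
    _ ≤ _ := by gcongr

/-- The pairs of points at distance at most `D` whose segment passes within `r` of `p`. -/
def hitSet (p : E2) (D r : ℝ) : Set (E2 × E2) :=
  {w | dist w.1 w.2 ≤ D ∧ ∃ z ∈ segment ℝ w.1 w.2, dist z p ≤ r}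

theorem isClosed_hitSet (p : E2) (D r : ℝ) : IsClosed (hitSet p D r) := by
  have h : hitSet p D r = {w | dist w.1 w.2 ≤ D} ∩ Prod.snd ''
      {w : unitInterval × (E2 × E2) | dist ((1 - (w.1 : ℝ)) • w.2.1 + (w.1 : ℝ) • w.2.2) p ≤ r} := by
    ext w
    simp only [hitSet, segment_eq_image, Set.mem_ofPred_eq, Set.mem_inter_iff, Set.mem_image]
    refine and_congr_right fun _ => ⟨?_, ?_⟩
    · rintro ⟨_, ⟨s, hs, rfl⟩, hz⟩
      exact ⟨(⟨s, hs⟩, w), hz, rfl⟩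
    · rintro ⟨⟨s, w'⟩, hz, rfl⟩
      exact ⟨_, ⟨s, s.2, rfl⟩, hz⟩
  rw [h]
  refine (isClosed_le (by fun_prop) continuous_const).inter
    (isClosedMap_snd_of_compactSpace _ (isClosed_le ?_ continuous_const))
  fun_prop

theorem volume_hitSet_le (p : E2) {D r : ℝ} (hr : 0 < r) :
    (volume.prod volume) (hitSet p D r)
      ≤ ENNReal.ofReal (tubeArea D r) * volume (Metric.closedBall (0 : E2) D) := by
  have hmp := measurePreserving_prod_add (volume : Measure E2) (volume : Measure E2)
  have hmeas := (isClosed_hitSet p D r).measurableSet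
  rw [← hmp.measure_preimage hmeas.nullMeasurableSet,
    Measure.prod_apply_symm (hmp.measurable hmeas)]
  calc _ ≤ ∫⁻ z : E2, (Metric.closedBall (0 : E2) D).indicator
        (fun _ => ENNReal.ofReal (tubeArea D r)) z := lintegral_mono fun z => ?_
    _ = _ := lintegral_indicator_const Metric.isClosed_closedBall.measurableSet _
  by_cases hz : z ∈ Metric.closedBall (0 : E2) D
  · rw [Set.indicator_of_mem hz]
    have hd : dist (p - z) p ≤ D := by simpa using hz
    refine (measure_mono ?_).trans (volume_segment_nhds_le (p - z) p hd hr)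
    rintro x ⟨-, y, hy, hyp⟩
    refine ⟨x + (p - y), ?_, ?_⟩
    · obtain ⟨s, s', hs, hs', hss, rfl⟩ := hy
      refine ⟨s', s, hs', hs, by rw [add_comm, hss], ?_⟩
      have : s' = 1 - s := by linarith
      subst this
      module
    · rw [dist_comm] at hyp
      simpa [dist_eq_norm, norm_sub_rev] using hyp
  · rw [Set.indicator_of_notMem hz, nonpos_iff_eq_zero]
    convert measure_empty (μ := (volume : Measure E2))
    refine Set.eq_empty_of_forall_notMem fun x hx => hz ?_
    simpa using hx.1

theorem volume_hitSet_zero (p : E2) (D : ℝ) : (volume.prod volume) (hitSet p D 0) = 0 := by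
  have hlim : Filter.Tendsto (fun r => ENNReal.ofReal (tubeArea D r)
      * volume (Metric.closedBall (0 : E2) D)) (nhdsWithin 0 (Set.Ioi 0)) (nhds 0) := by
    have h1 : Filter.Tendsto (fun r => tubeArea D r) (nhdsWithin 0 (Set.Ioi 0)) (nhds 0) := by
      have : Continuous fun r => tubeArea D r := by unfold tubeArea; fun_prop
      have h := (this.tendsto 0).mono_left (nhdsWithin_le_nhds (s := Set.Ioi 0))
      simpa [tubeArea] using h
    have h2 := ENNReal.Tendsto.mul_const (ENNReal.tendsto_ofReal h1)
      (b := volume (Metric.closedBall (0 : E2) D)) (Or.inr measure_closedBall_lt_top.ne)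
    simpa using h2
  refine le_antisymm (ge_of_tendsto hlim ?_) zero_le
  filter_upwards [self_mem_nhdsWithin] with r hr
  refine (measure_mono ?_).trans (volume_hitSet_le p hr)
  rintro w ⟨hw, z, hz, hzp⟩
  exact ⟨hw, z, hz, hzp.trans (le_of_lt hr)⟩

theorem Tri.interior_ae_eq (t : Tri) : interior t.carrier =ᵐ[volume] t.carrier :=
  interior_ae_eq_of_null_frontier (t.convex_carrier.addHaar_frontier volume)

theorem Tri.area_eq_interior (t : Tri) : t.area = volume.real (interior t.carrier) :=
  (measureReal_congr t.interior_ae_eq).symm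

namespace Mesh

variable {Ω : Set E2} (M : Mesh Ω)

theorem pairwiseDisjoint_interior :
    (M.tris : Set Tri).PairwiseDisjoint fun t => interior t.carrier :=
  fun t ht s hs hne => Set.disjoint_iff_inter_eq_empty.2 (M.interior_disjoint t ht s hs hne)

theorem sum_area_le {F : Finset Tri} (hF : F ⊆ M.tris) {S : Set E2}
    (hS : ∀ t ∈ F, t.carrier ⊆ S) (hSf : volume S ≠ ⊤) : ∑ t ∈ F, t.area ≤ volume.real S := by
  simp_rw [Tri.area_eq_interior]
  have hsub : (⋃ t ∈ F, interior t.carrier) ⊆ S :=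
    Set.iUnion₂_subset fun t ht => interior_subset.trans (hS t ht)
  rw [← measureReal_biUnion_finset (M.pairwiseDisjoint_interior.subset hF)
    (fun t _ => isOpen_interior.measurableSet)
    (fun t ht => ne_top_of_le_ne_top hSf (measure_mono (interior_subset.trans (hS t ht))))]
  exact measureReal_mono hsub hSf

variable {M} {Creg : ℝ}

/-- A segment of length at most `D` meets `O(1 / h)` triangles. -/
theorem Regular.card_mul_le (hC : 0 < Creg) (hM : M.Regular Creg) {x y : E2} {D : ℝ}
    (hD : dist x y ≤ D) :
    ((M.tris.filter fun s => (segment ℝ x y ∩ s.carrier).Nonempty).card : ℝ)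
      * (Creg ^ 3 / 2 * M.meshSize ^ 2) ≤ tubeArea D M.meshSize := by
  have hh := M.meshSize_pos
  have hvol := volume_segment_nhds_le x y hD hh
  have hD0 : 0 ≤ D := dist_nonneg.trans hD
  have hpi := Real.pi_pos
  have h1 := M.sum_area_le (F := M.tris.filter fun s => (segment ℝ x y ∩ s.carrier).Nonempty)
    (Finset.filter_subset _ _) (S := {z : E2 | ∃ p ∈ segment ℝ x y, dist z p ≤ M.meshSize})
    (by
      intro t ht z hz
      obtain ⟨ht, p, hp, hpt⟩ := Finset.mem_filter.1 ht
      exact ⟨p, hp, M.dist_le_meshSize ht hz hpt⟩)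
    (ne_top_of_le_ne_top ENNReal.ofReal_ne_top hvol)
  rw [← nsmul_eq_mul]
  refine (Finset.card_nsmul_le_sum _ _ _ fun t ht => ?_).trans (h1.trans ?_)
  · exact hM.area_ge hC (Finset.mem_filter.1 ht).1
  · exact ENNReal.toReal_le_of_le_ofReal (by unfold tubeArea; positivity) hvol

/-- The mesh size is bounded in terms of the domain and of the regularity constant. -/
theorem Regular.mul_meshSize_le (hM : M.Regular Creg) {D : ℝ}
    (hD : ∀ x ∈ closure Ω, ∀ y ∈ closure Ω, dist x y ≤ D) : Creg * M.meshSize ≤ D := by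
  obtain ⟨t, ht⟩ := M.tris_nonempty
  have hsub : t.carrier ⊆ closure Ω := by
    rw [← M.union_eq]
    exact Set.subset_iUnion₂ (s := fun (t : Tri) (_ : t ∈ (M.tris : Set Tri)) => t.carrier) t ht
  exact (hM.le_dist ht (show (0 : Fin 3) ≠ 1 by decide)).trans
    (hD _ (hsub (t.vtx_mem_carrier 0)) _ (hsub (t.vtx_mem_carrier 1)))

variable (M)

/-- The double sum of the squared differences of the centroid values of a piecewise affine
function, weighted by the areas of the parts of the triangles lying in `A`. -/
def variation (q : Tri → (E2 →ᵃ[ℝ] ℝ)) (A : Set E2) : ℝ :=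
  ∑ K ∈ M.tris, ∑ L ∈ M.tris, volume.real (interior K.carrier ∩ A)
    * volume.real (interior L.carrier ∩ A) * (q K K.centroid - q L L.centroid) ^ 2

variable {M}

theorem Regular.sq_centroid_sub_le (hC : 0 < Creg) (hM : M.Regular Creg)
    {q : Tri → (E2 →ᵃ[ℝ] ℝ)} (hq : M.IsP1nc q) {D κ : ℝ}
    (hκ : tubeArea D M.meshSize ≤ κ * M.meshSize) {t t' : Tri}
    (ht : t ∈ M.tris) (ht' : t' ∈ M.tris) {x y : E2} (hx : x ∈ t.carrier) (hy : y ∈ t'.carrier)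
    (hxy : segment ℝ x y ⊆ closure Ω) (hD : dist x y ≤ D)
    (hv : ∀ s ∈ M.tris, ∀ i, (x, y) ∉ hitSet (s.vtx i) D 0) :
    (q t t.centroid - q t' t'.centroid) ^ 2
      ≤ ∑ s ∈ M.tris, (hitSet s.centroid D M.meshSize).indicator
        (fun _ => 8 * κ / Creg ^ 3 * (M.meshSize * ‖gradh q s‖ ^ 2)) (x, y) := by
  have hh := M.meshSize_pos
  have h1 := M.abs_centroid_sub_le_of_segment hq ht ht' hx hy hxy
    fun s hs i hi => hv s hs i ⟨hD, _, hi, (dist_self _).le⟩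
  have hcard := hM.card_mul_le hC hD
  set F := M.tris.filter fun s => (segment ℝ x y ∩ s.carrier).Nonempty with hF
  have hcard' : (F.card : ℝ) * M.meshSize ≤ 2 * κ / Creg ^ 3 := by
    rw [le_div_iff₀ (by positivity)]
    refine le_of_mul_le_mul_right ?_ hh
    nlinarith [hcard.trans hκ]
  calc (q t t.centroid - q t' t'.centroid) ^ 2
      ≤ (∑ s ∈ F, 2 * (M.meshSize * ‖gradh q s‖)) ^ 2 := sq_le_sq' (abs_le.1 h1).1 (abs_le.1 h1).2
    _ ≤ F.card * ∑ s ∈ F, (2 * (M.meshSize * ‖gradh q s‖)) ^ 2 := sq_sum_le_card_mul_sum_sq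
    _ = ∑ s ∈ F, (F.card * M.meshSize) * (4 * (M.meshSize * ‖gradh q s‖ ^ 2)) := by
        rw [Finset.mul_sum]
        exact Finset.sum_congr rfl fun s _ => by ring
    _ ≤ ∑ s ∈ F, 2 * κ / Creg ^ 3 * (4 * (M.meshSize * ‖gradh q s‖ ^ 2)) := by
        gcongr
    _ = ∑ s ∈ F, (hitSet s.centroid D M.meshSize).indicator
        (fun _ => 8 * κ / Creg ^ 3 * (M.meshSize * ‖gradh q s‖ ^ 2)) (x, y) := by
        refine Finset.sum_congr rfl fun s hs => ?_
        obtain ⟨hs, z, hz, hzs⟩ := Finset.mem_filter.1 hs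
        rw [Set.indicator_of_mem]
        · ring
        · exact ⟨hD, z, hz, M.dist_le_meshSize hs hzs s.centroid_mem_carrier⟩
    _ ≤ _ := by
        refine Finset.sum_le_sum_of_subset_of_nonneg (Finset.filter_subset _ _) fun s _ _ => ?_
        refine Set.indicator_nonneg (fun _ _ => ?_) _
        have : 0 ≤ 2 * κ / Creg ^ 3 := le_trans (by positivity) hcard'
        have h8 : 8 * κ / Creg ^ 3 = 4 * (2 * κ / Creg ^ 3) := by ring
        rw [h8]
        positivity

/-- The discrete Poincaré estimate on a convex part of the closed domain. -/
theorem Regular.variation_le_of_convex (hC : 0 < Creg) (hM : M.Regular Creg)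
    {q : Tri → (E2 →ᵃ[ℝ] ℝ)} (hq : M.IsP1nc q) {D κ : ℝ}
    (hκ : tubeArea D M.meshSize ≤ κ * M.meshSize)
    (hD : ∀ x ∈ closure Ω, ∀ y ∈ closure Ω, dist x y ≤ D) {A : Set E2} (hA : Convex ℝ A)
    (hAm : MeasurableSet A) (hAΩ : A ⊆ closure Ω) (hAf : volume A ≠ ⊤) :
    M.variation q A ≤ 16 * κ ^ 2 / Creg ^ 6 * volume.real (Metric.closedBall (0 : E2) D)
      * M.l2P0 (gradh q) (gradh q) := by
  have hh := M.meshSize_pos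
  have : IsFiniteMeasure ((volume : Measure E2).restrict A) := ⟨by simpa using hAf.lt_top⟩
  set ρ : Measure (E2 × E2) := (volume.restrict A).prod (volume.restrict A) with hρ
  have hρr : ρ = (volume.prod volume).restrict (A ×ˢ A) := Measure.prod_restrict A A
  set c : Tri → ℝ := fun s => 8 * κ / Creg ^ 3 * (M.meshSize * ‖gradh q s‖ ^ 2) with hc
  set H : Tri → Set (E2 × E2) := fun s => hitSet s.centroid D M.meshSize with hH
  have hHm : ∀ s, MeasurableSet (H s) := fun s => (isClosed_hitSet _ _ _).measurableSet
  set R : Tri × Tri → Set (E2 × E2) := fun w => interior w.1.carrier ×ˢ interior w.2.carrier with hR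
  have hRm : ∀ w, MeasurableSet (R w) := fun w =>
    isOpen_interior.measurableSet.prod isOpen_interior.measurableSet
  have hκ0 : 0 ≤ κ := by
    obtain ⟨t, ht⟩ := M.tris_nonempty
    have hD0 : 0 ≤ D := by
      have : (closure Ω).Nonempty := by
        rw [← M.union_eq]
        exact ⟨t.vtx 0, Set.mem_iUnion₂.2 ⟨t, ht, t.vtx_mem_carrier 0⟩⟩
      obtain ⟨x, hx⟩ := this
      exact dist_nonneg.trans (hD x hx x hx)
    have hpi := Real.pi_pos
    have : 0 ≤ tubeArea D M.meshSize := by unfold tubeArea; positivity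
    exact nonneg_of_mul_nonneg_left (this.trans hκ) hh
  have hc0 : ∀ s, 0 ≤ c s := fun s => by simp only [hc]; positivity
  have hpair : ∀ w ∈ M.tris ×ˢ M.tris,
      ρ.real (R w) * (q w.1 w.1.centroid - q w.2 w.2.centroid) ^ 2
        ≤ ∑ s ∈ M.tris, ρ.real (H s ∩ R w) * c s := by
    intro w hw
    obtain ⟨hw1, hw2⟩ := Finset.mem_product.1 hw
    have hae : ∀ᵐ z ∂(ρ.restrict (R w)), (q w.1 w.1.centroid - q w.2 w.2.centroid) ^ 2
        ≤ ∑ s ∈ M.tris, (H s).indicator (fun _ => c s) z := by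
      have h1 : ∀ᵐ z ∂ρ, z ∈ A ×ˢ A := by
        rw [hρr]
        exact ae_restrict_mem (hAm.prod hAm)
      have h2 : ∀ᵐ z ∂ρ, ∀ s ∈ M.tris, ∀ i, z ∉ hitSet (s.vtx i) D 0 := by
        rw [hρr]
        refine ae_restrict_of_ae ((Finset.eventually_all _).2 fun s _ => ae_all_iff.2 fun i => ?_)
        exact measure_eq_zero_iff_ae_notMem.1 (volume_hitSet_zero _ _)
      filter_upwards [ae_restrict_mem (hRm w), ae_restrict_of_ae h1, ae_restrict_of_ae h2]
        with z hz hzA hzv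
      exact hM.sq_centroid_sub_le hC hq hκ hw1 hw2 (interior_subset hz.1) (interior_subset hz.2)
        ((hA.segment_subset hzA.1 hzA.2).trans hAΩ) (hD _ (hAΩ hzA.1) _ (hAΩ hzA.2)) hzv
    have hintg : ∀ s ∈ M.tris, Integrable ((H s).indicator fun _ => c s) (ρ.restrict (R w)) :=
      fun s _ => (integrable_const _).indicator (hHm s)
    have := integral_mono_ae (integrable_const _) (integrable_finsetSum _ hintg) hae
    rw [integral_finsetSum _ hintg, integral_const, measureReal_restrict_apply_univ,
      smul_eq_mul] at this
    refine this.trans (Finset.sum_le_sum fun s _ => ?_)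
    rw [integral_indicator_const _ (hHm s), measureReal_restrict_apply (hHm s), smul_eq_mul]
  have hsum : ∀ s ∈ M.tris, ∑ w ∈ M.tris ×ˢ M.tris, ρ.real (H s ∩ R w)
      ≤ κ * M.meshSize * volume.real (Metric.closedBall (0 : E2) D) := by
    intro s hs
    have hdisj : ((M.tris ×ˢ M.tris : Finset (Tri × Tri)) : Set (Tri × Tri)).PairwiseDisjoint
        fun w => H s ∩ R w := by
      intro w hw w' hw' hne
      rw [Finset.mem_coe, Finset.mem_product] at hw hw'
      refine Disjoint.mono Set.inter_subset_right Set.inter_subset_right ?_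
      rw [Set.disjoint_prod]
      by_cases h : w.1 = w'.1
      · exact Or.inr (M.pairwiseDisjoint_interior hw.2 hw'.2 fun h' => hne (Prod.ext h h'))
      · exact Or.inl (M.pairwiseDisjoint_interior hw.1 hw'.1 h)
    rw [← measureReal_biUnion_finset hdisj fun w _ => (hHm s).inter (hRm w)]
    have hle : ρ (⋃ w ∈ M.tris ×ˢ M.tris, H s ∩ R w)
        ≤ ENNReal.ofReal (κ * M.meshSize) * volume (Metric.closedBall (0 : E2) D) := by
      refine (measure_mono (Set.iUnion₂_subset fun w _ => Set.inter_subset_left)).trans ?_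
      rw [hρr]
      refine (Measure.restrict_apply_le _ _).trans ((volume_hitSet_le _ hh).trans ?_)
      gcongr
    have := ENNReal.toReal_mono
      (ENNReal.mul_ne_top ENNReal.ofReal_ne_top measure_closedBall_lt_top.ne) hle
    rwa [ENNReal.toReal_mul, ENNReal.toReal_ofReal (by positivity)] at this
  calc M.variation q A
      = ∑ w ∈ M.tris ×ˢ M.tris,
        ρ.real (R w) * (q w.1 w.1.centroid - q w.2 w.2.centroid) ^ 2 := by
        rw [variation, Finset.sum_product]
        refine Finset.sum_congr rfl fun K _ => Finset.sum_congr rfl fun L _ => ?_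
        rw [hR, hρ, measureReal_prod_prod, measureReal_restrict_apply isOpen_interior.measurableSet,
          measureReal_restrict_apply isOpen_interior.measurableSet]
    _ ≤ ∑ w ∈ M.tris ×ˢ M.tris, ∑ s ∈ M.tris, ρ.real (H s ∩ R w) * c s :=
        Finset.sum_le_sum hpair
    _ = ∑ s ∈ M.tris, (∑ w ∈ M.tris ×ˢ M.tris, ρ.real (H s ∩ R w)) * c s := by
        rw [Finset.sum_comm]
        exact Finset.sum_congr rfl fun s _ => (Finset.sum_mul _ _ _).symm
    _ ≤ ∑ s ∈ M.tris, κ * M.meshSize * volume.real (Metric.closedBall (0 : E2) D) * c s :=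
        Finset.sum_le_sum fun s hs => mul_le_mul_of_nonneg_right (hsum s hs) (hc0 s)
    _ = ∑ s ∈ M.tris, 16 * κ ^ 2 / Creg ^ 6 * volume.real (Metric.closedBall (0 : E2) D)
          * (Creg ^ 3 / 2 * M.meshSize ^ 2 * ‖gradh q s‖ ^ 2) := by
        refine Finset.sum_congr rfl fun s _ => ?_
        simp only [hc]
        field_simp
        ring
    _ ≤ _ := by
        rw [l2P0, Finset.mul_sum]
        refine Finset.sum_le_sum fun s hs => ?_
        rw [real_inner_self_eq_norm_sq]
        have := hM.area_ge hC hs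
        gcongr

end Mesh

/-- Comparison of weighted double sums of squared differences, with an intermediate weight `e`
below both `a` and `b`. -/
theorem sum_sq_sub_le {ι : Type*} (S : Finset ι) (u a b e w : ι → ℝ) (he : ∀ i, 0 ≤ e i)
    (hw : ∀ i, 0 ≤ w i) (hea : ∀ i, e i ≤ a i) (heb : ∀ i, e i ≤ b i)
    (hwab : ∀ i, w i ≤ a i + b i) :
    (∑ k ∈ S, e k) * ∑ i ∈ S, ∑ j ∈ S, w i * w j * (u i - u j) ^ 2
      ≤ (∑ k ∈ S, e k + 4 * ∑ k ∈ S, b k) * ∑ i ∈ S, ∑ j ∈ S, a i * a j * (u i - u j) ^ 2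
        + (∑ k ∈ S, e k + 4 * ∑ k ∈ S, a k)
          * ∑ i ∈ S, ∑ j ∈ S, b i * b j * (u i - u j) ^ 2 := by
  have ha : ∀ i, 0 ≤ a i := fun i => (he i).trans (hea i)
  have hb : ∀ i, 0 ≤ b i := fun i => (he i).trans (heb i)
  have hmix : (∑ k ∈ S, e k) * ∑ i ∈ S, ∑ j ∈ S, a i * b j * (u i - u j) ^ 2
      ≤ 2 * (∑ k ∈ S, b k) * ∑ i ∈ S, ∑ j ∈ S, a i * a j * (u i - u j) ^ 2
        + 2 * (∑ k ∈ S, a k) * ∑ i ∈ S, ∑ j ∈ S, b i * b j * (u i - u j) ^ 2 := by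
    calc (∑ k ∈ S, e k) * ∑ i ∈ S, ∑ j ∈ S, a i * b j * (u i - u j) ^ 2
        = ∑ k ∈ S, ∑ i ∈ S, ∑ j ∈ S, e k * (a i * b j * (u i - u j) ^ 2) := by
          rw [Finset.sum_mul]
          simp only [Finset.mul_sum]
      _ ≤ ∑ k ∈ S, ∑ i ∈ S, ∑ j ∈ S, (2 * b j * (a k * a i * (u k - u i) ^ 2)
          + 2 * a i * (b k * b j * (u k - u j) ^ 2)) := by
          refine Finset.sum_le_sum fun k _ => Finset.sum_le_sum fun i _ =>
            Finset.sum_le_sum fun j _ => ?_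
          have hsq : (u i - u j) ^ 2 ≤ 2 * (u k - u i) ^ 2 + 2 * (u k - u j) ^ 2 := by
            nlinarith [sq_nonneg (u i + u j - 2 * u k)]
          have hai := ha i
          have hbj := hb j
          have hek := he k
          have hak := hea k
          have hbk := heb k
          calc e k * (a i * b j * (u i - u j) ^ 2)
              ≤ e k * (a i * b j * (2 * (u k - u i) ^ 2 + 2 * (u k - u j) ^ 2)) := by gcongr
            _ = 2 * b j * (e k * a i * (u k - u i) ^ 2)
                + 2 * a i * (e k * b j * (u k - u j) ^ 2) := by ring
            _ ≤ _ := by gcongr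
      _ = _ := by
          simp only [Finset.sum_add_distrib]
          congr 1
          · simp only [← Finset.sum_mul, ← Finset.mul_sum]
          · rw [Finset.mul_sum]
            refine Finset.sum_congr rfl fun k _ => ?_
            simp only [← Finset.sum_mul, ← Finset.mul_sum]
  have hsym : ∑ i ∈ S, ∑ j ∈ S, b i * a j * (u i - u j) ^ 2
      = ∑ i ∈ S, ∑ j ∈ S, a i * b j * (u i - u j) ^ 2 := by
    rw [Finset.sum_comm]
    exact Finset.sum_congr rfl fun i _ => Finset.sum_congr rfl fun j _ => by ring
  have hexp : ∑ i ∈ S, ∑ j ∈ S, w i * w j * (u i - u j) ^ 2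
      ≤ ∑ i ∈ S, ∑ j ∈ S, a i * a j * (u i - u j) ^ 2
        + ∑ i ∈ S, ∑ j ∈ S, b i * b j * (u i - u j) ^ 2
        + 2 * ∑ i ∈ S, ∑ j ∈ S, a i * b j * (u i - u j) ^ 2 := by
    calc _ ≤ ∑ i ∈ S, ∑ j ∈ S, (a i + b i) * (a j + b j) * (u i - u j) ^ 2 := by
          refine Finset.sum_le_sum fun i _ => Finset.sum_le_sum fun j _ => ?_
          have := hw i
          have := hw j
          have := hwab i
          have := hwab j
          gcongr
          linarith
      _ = ∑ i ∈ S, ∑ j ∈ S, a i * a j * (u i - u j) ^ 2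
          + ∑ i ∈ S, ∑ j ∈ S, b i * b j * (u i - u j) ^ 2
          + ∑ i ∈ S, ∑ j ∈ S, a i * b j * (u i - u j) ^ 2
          + ∑ i ∈ S, ∑ j ∈ S, b i * a j * (u i - u j) ^ 2 := by
          simp only [← Finset.sum_add_distrib]
          exact Finset.sum_congr rfl fun i _ => Finset.sum_congr rfl fun j _ => by ring
      _ = _ := by rw [hsym]; ring
  have hE : 0 ≤ ∑ k ∈ S, e k := Finset.sum_nonneg fun k _ => he k
  have := mul_le_mul_of_nonneg_left hexp hE
  linarith

namespace Mesh

variable {Ω : Set E2} (M : Mesh Ω)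

theorem carrier_subset_closure {t : Tri} (ht : t ∈ M.tris) : t.carrier ⊆ closure Ω := by
  rw [← M.union_eq]
  exact Set.subset_iUnion₂ (s := fun (t : Tri) (_ : t ∈ (M.tris : Set Tri)) => t.carrier) t ht

theorem sum_volume_interior_inter {S : Set E2} (hS : S ⊆ closure Ω) (hSf : volume S ≠ ⊤) :
    ∑ t ∈ M.tris, volume.real (interior t.carrier ∩ S) = volume.real S := by
  have hfin : IsFiniteMeasure ((volume : Measure E2).restrict S) := ⟨by simpa using hSf.lt_top⟩
  simp_rw [← measureReal_restrict_apply (μ := volume) (s := S)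
    (isOpen_interior (s := Tri.carrier _)).measurableSet]
  rw [← measureReal_biUnion_finset M.pairwiseDisjoint_interior
    fun t _ => isOpen_interior.measurableSet, measureReal_restrict_apply
      (Finset.measurableSet_biUnion _ fun t _ => isOpen_interior.measurableSet)]
  refine measureReal_congr ?_
  have hae : ∀ᵐ x ∂(volume : Measure E2), ∀ t ∈ M.tris,
      (x ∈ interior t.carrier ↔ x ∈ t.carrier) :=
    (Finset.eventually_all _).2 fun t _ => t.interior_ae_eq.mem_iff
  refine Filter.eventuallyEq_set.2 ?_
  filter_upwards [hae] with x hx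
  refine ⟨fun h => h.2, fun h => ⟨?_, h⟩⟩
  have hxΩ := hS h
  rw [← M.union_eq] at hxΩ
  obtain ⟨t, ht, hxt⟩ := Set.mem_iUnion₂.1 hxΩ
  exact Set.mem_iUnion₂.2 ⟨t, ht, (hx t ht).2 hxt⟩

theorem l2P0_self_nonneg (v : Tri → E2) : 0 ≤ M.l2P0 v v :=
  Finset.sum_nonneg fun t _ => mul_nonneg t.area_pos.le real_inner_self_nonneg

end Mesh

/-- The discrete Poincaré estimate holds on the part `A` of the closed domain, uniformly over all
regular meshes. -/
def PoincareOn (Ω : Set E2) (Creg : ℝ) (A : Set E2) : Prop :=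
  ∃ C, 0 ≤ C ∧ ∀ M : Mesh Ω, M.Regular Creg → ∀ q : Tri → (E2 →ᵃ[ℝ] ℝ), M.IsP1nc q →
    M.variation q A ≤ C * M.l2P0 (gradh q) (gradh q)

namespace PoincareOn

variable {Ω A B : Set E2} {Creg : ℝ}

theorem mono (h : PoincareOn Ω Creg B) (hAB : A ⊆ B) (hB : volume B ≠ ⊤) :
    PoincareOn Ω Creg A := by
  obtain ⟨C, hC, h⟩ := h
  refine ⟨C, hC, fun M hM q hq => le_trans ?_ (h M hM q hq)⟩
  have hle : ∀ t : Tri, volume.real (interior t.carrier ∩ A)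
      ≤ volume.real (interior t.carrier ∩ B) := fun t =>
    measureReal_mono (Set.inter_subset_inter_right _ hAB)
      (ne_top_of_le_ne_top hB (measure_mono Set.inter_subset_right))
  refine Finset.sum_le_sum fun K _ => Finset.sum_le_sum fun L _ => ?_
  have := hle K
  have := hle L
  gcongr

theorem union (hA : PoincareOn Ω Creg A) (hB : PoincareOn Ω Creg B) (hAΩ : A ⊆ closure Ω)
    (hBΩ : B ⊆ closure Ω) (hAf : volume A ≠ ⊤) (hBf : volume B ≠ ⊤)
    (hAB : 0 < volume (A ∩ B)) : PoincareOn Ω Creg (A ∪ B) := by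
  obtain ⟨CA, hCA, hA⟩ := hA
  obtain ⟨CB, hCB, hB⟩ := hB
  have hIf : volume (A ∩ B) ≠ ⊤ := ne_top_of_le_ne_top hAf (measure_mono Set.inter_subset_left)
  have hδ : 0 < volume.real (A ∩ B) := ENNReal.toReal_pos hAB.ne' hIf
  refine ⟨((volume.real (A ∩ B) + 4 * volume.real B) * CA
    + (volume.real (A ∩ B) + 4 * volume.real A) * CB) / volume.real (A ∩ B), by positivity,
    fun M hM q hq => ?_⟩
  have hsub : ∀ (t : Tri) {S : Set E2}, volume S ≠ ⊤ → volume (interior t.carrier ∩ S) ≠ ⊤ :=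
    fun t S hS => ne_top_of_le_ne_top hS (measure_mono Set.inter_subset_right)
  have key := sum_sq_sub_le M.tris (fun t => q t t.centroid)
    (fun t => volume.real (interior t.carrier ∩ A)) (fun t => volume.real (interior t.carrier ∩ B))
    (fun t => volume.real (interior t.carrier ∩ (A ∩ B)))
    (fun t => volume.real (interior t.carrier ∩ (A ∪ B)))
    (fun t => measureReal_nonneg) (fun t => measureReal_nonneg)
    (fun t => measureReal_mono (Set.inter_subset_inter_right _ Set.inter_subset_left)
      (hsub t hAf))
    (fun t => measureReal_mono (Set.inter_subset_inter_right _ Set.inter_subset_right)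
      (hsub t hBf))
    (fun t => by rw [Set.inter_union_distrib_left]; exact measureReal_union_le _ _)
  rw [M.sum_volume_interior_inter (Set.inter_subset_left.trans hAΩ) hIf,
    M.sum_volume_interior_inter hAΩ hAf, M.sum_volume_interior_inter hBΩ hBf] at key
  rw [div_mul_eq_mul_div, le_div_iff₀ hδ, mul_comm]
  refine key.trans ?_
  have h1 := hA M hM q hq
  have h2 := hB M hM q hq
  rw [Mesh.variation] at h1 h2
  calc _ ≤ (volume.real (A ∩ B) + 4 * volume.real B) * (CA * M.l2P0 (gradh q) (gradh q))
      + (volume.real (A ∩ B) + 4 * volume.real A) * (CB * M.l2P0 (gradh q) (gradh q)) := by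
        gcongr
    _ = _ := by ring

theorem of_convex (hC : 0 < Creg) (hΩb : Bornology.IsBounded Ω) (hA : Convex ℝ A)
    (hAm : MeasurableSet A) (hAΩ : A ⊆ closure Ω) : PoincareOn Ω Creg A := by
  have hb : Bornology.IsBounded (closure Ω) := hΩb.closure
  obtain ⟨D, hD⟩ := Metric.isBounded_iff.1 hb
  refine ⟨16 * (4 * Real.pi * (D + 3 * (D / Creg))) ^ 2 / Creg ^ 6
    * volume.real (Metric.closedBall (0 : E2) D), by positivity, fun M hM q hq => ?_⟩
  have hD' : ∀ x ∈ closure Ω, ∀ y ∈ closure Ω, dist x y ≤ D := fun x hx y hy => hD hx hy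
  refine hM.variation_le_of_convex hC hq ?_ hD' hA hAm hAΩ (hb.subset hAΩ).measure_lt_top.ne
  have hh := M.meshSize_pos
  have hle : M.meshSize ≤ D / Creg := by
    rw [le_div_iff₀ hC, mul_comm]
    exact hM.mul_meshSize_le hD'
  have hpi := Real.pi_pos
  rw [tubeArea, ← mul_assoc]
  gcongr

end PoincareOn

theorem Tri.nonempty_interior (t : Tri) : (interior t.carrier).Nonempty := by
  rw [Set.nonempty_iff_ne_empty]
  intro h
  have := t.area_pos
  rw [t.area_eq_interior, h, measureReal_empty] at this
  exact lt_irrefl 0 this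

theorem Tri.volume_inter_ball_pos (t : Tri) {x : E2} (hx : x ∈ t.carrier) {r : ℝ} (hr : 0 < r) :
    0 < volume (t.carrier ∩ Metric.ball x r) := by
  have hcl : x ∈ closure (interior t.carrier) := by
    rw [t.convex_carrier.closure_interior_eq_closure_of_nonempty_interior t.nonempty_interior]
    exact subset_closure hx
  obtain ⟨y, hy, hyt⟩ := mem_closure_iff.1 hcl _ Metric.isOpen_ball (Metric.mem_ball_self hr)
  refine lt_of_lt_of_le ((isOpen_interior.inter Metric.isOpen_ball).measure_pos volume
    ⟨y, hyt, hy⟩) (measure_mono (Set.inter_subset_inter_left _ interior_subset))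

namespace Mesh

variable {Ω : Set E2} (M : Mesh Ω)

theorem nonempty_inter_carrier {t : Tri} (ht : t ∈ M.tris) : (Ω ∩ t.carrier).Nonempty := by
  obtain ⟨x, hx⟩ := t.nonempty_interior
  obtain ⟨y, hyt, hy⟩ := mem_closure_iff.1 (M.carrier_subset_closure ht (interior_subset hx)) _
    isOpen_interior hx
  exact ⟨y, hy, interior_subset hyt⟩

/-- A proper nonempty family of triangles has a triangle outside of it touching it inside `Ω`. -/
theorem exists_neighbour (hΩc : IsConnected Ω) {F : Finset Tri} (hF : F ⊂ M.tris)
    (hne : F.Nonempty) :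
    ∃ t ∈ F, ∃ t' ∈ M.tris \ F, ∃ x ∈ Ω, x ∈ t.carrier ∧ x ∈ t'.carrier := by
  obtain ⟨t, ht⟩ := hne
  obtain ⟨t', ht'⟩ : (M.tris \ F).Nonempty := Finset.sdiff_nonempty.2 hF.2
  obtain ⟨y, hy, hyt⟩ := M.nonempty_inter_carrier (hF.1 ht)
  obtain ⟨y', hy', hyt'⟩ := M.nonempty_inter_carrier (Finset.mem_sdiff.1 ht').1
  obtain ⟨x, hx, hx1, hx2⟩ := isPreconnected_closed_iff.1 hΩc.isPreconnected
    (⋃ s ∈ F, s.carrier) (⋃ s ∈ M.tris \ F, s.carrier)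
    (F.finite_toSet.isClosed_biUnion fun s _ => s.isCompact_carrier.isClosed)
    ((M.tris \ F).finite_toSet.isClosed_biUnion fun s _ => s.isCompact_carrier.isClosed)
    (by
      intro z hz
      have := subset_closure hz
      rw [← M.union_eq] at this
      obtain ⟨s, hs, hzs⟩ := Set.mem_iUnion₂.1 this
      by_cases hsF : s ∈ F
      · exact Or.inl (Set.mem_iUnion₂.2 ⟨s, hsF, hzs⟩)
      · exact Or.inr (Set.mem_iUnion₂.2 ⟨s, Finset.mem_sdiff.2 ⟨hs, hsF⟩, hzs⟩))
    ⟨y, hy, Set.mem_iUnion₂.2 ⟨t, ht, hyt⟩⟩ ⟨y', hy', Set.mem_iUnion₂.2 ⟨t', ht', hyt'⟩⟩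
  obtain ⟨s, hs, hxs⟩ := Set.mem_iUnion₂.1 hx1
  obtain ⟨s', hs', hxs'⟩ := Set.mem_iUnion₂.1 hx2
  exact ⟨s, hs, s', hs', x, hx, hxs, hxs'⟩

end Mesh

/-- The discrete Poincaré estimate holds on the whole domain. -/
theorem Mesh.poincareOn_closure {Ω : Set E2} (M : Mesh Ω) (hΩo : IsOpen Ω) (hΩc : IsConnected Ω) (hΩb : Bornology.IsBounded Ω)
    {Creg : ℝ} (hC : 0 < Creg) : PoincareOn Ω Creg (closure Ω) := by
  have hfin : ∀ {S : Set E2}, S ⊆ closure Ω → volume S ≠ ⊤ := fun hS =>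
    (hΩb.closure.subset hS).measure_lt_top.ne
  have hsub : ∀ F ⊆ M.tris, (⋃ t ∈ F, t.carrier) ⊆ closure Ω := fun F hF =>
    Set.iUnion₂_subset fun t ht => M.carrier_subset_closure (hF ht)
  have htri : ∀ t ∈ M.tris, PoincareOn Ω Creg t.carrier := fun t ht =>
    PoincareOn.of_convex hC hΩb t.convex_carrier t.isCompact_carrier.measurableSet
      (M.carrier_subset_closure ht)
  have key : ∀ n : ℕ, n + 1 ≤ M.tris.card →
      ∃ F ⊆ M.tris, F.card = n + 1 ∧ PoincareOn Ω Creg (⋃ t ∈ F, t.carrier) := by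
    intro n
    induction n with
    | zero =>
      intro _
      obtain ⟨t, ht⟩ := M.tris_nonempty
      refine ⟨{t}, Finset.singleton_subset_iff.2 ht, by simp, ?_⟩
      simpa using htri t ht
    | succ n ih =>
      intro hn
      obtain ⟨F, hF, hcard, hP⟩ := ih (by omega)
      have hFt : F ⊂ M.tris := Finset.ssubset_iff_subset_ne.2 ⟨hF, by rintro rfl; omega⟩
      obtain ⟨t, ht, t', ht', x, hx, hxt, hxt'⟩ :=
        M.exists_neighbour hΩc hFt (Finset.card_pos.1 (by omega))
      obtain ⟨ht', htF⟩ := Finset.mem_sdiff.1 ht'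
      obtain ⟨r, hr, hball⟩ := Metric.isOpen_iff.1 hΩo x hx
      have hballΩ : Metric.ball x r ⊆ closure Ω := hball.trans subset_closure
      have hB : PoincareOn Ω Creg (Metric.ball x r) :=
        PoincareOn.of_convex hC hΩb (convex_ball x r) measurableSet_ball hballΩ
      have hFΩ := hsub F hF
      have htΩ := M.carrier_subset_closure ht'
      have h1 : PoincareOn Ω Creg ((⋃ t ∈ F, t.carrier) ∪ Metric.ball x r) := by
        refine hP.union hB hFΩ hballΩ (hfin hFΩ) (hfin hballΩ) ?_
        refine lt_of_lt_of_le (t.volume_inter_ball_pos hxt hr) (measure_mono ?_)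
        exact Set.inter_subset_inter_left _
          (Set.subset_iUnion₂ (s := fun (t : Tri) (_ : t ∈ F) => t.carrier) t ht)
      have hFB := Set.union_subset hFΩ hballΩ
      have h2 := h1.union (htri t' ht') hFB htΩ (hfin hFB) (hfin htΩ) (by
        refine lt_of_lt_of_le (t'.volume_inter_ball_pos hxt' hr) (measure_mono ?_)
        rw [Set.inter_comm]
        exact Set.inter_subset_inter_left _ Set.subset_union_right)
      refine ⟨insert t' F, Finset.insert_subset ht' hF, by rw [Finset.card_insert_of_notMem htF,
        hcard], h2.mono ?_ (hfin (Set.union_subset hFB htΩ))⟩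
      rw [Finset.set_biUnion_insert]
      exact Set.union_subset Set.subset_union_right
        (Set.subset_union_left.trans Set.subset_union_left)
  have hpos : 0 < M.tris.card := Finset.card_pos.2 M.tris_nonempty
  obtain ⟨F, hF, hcard, hP⟩ := key (M.tris.card - 1) (by omega)
  have heq : F = M.tris := Finset.eq_of_subset_of_card_le hF (by omega)
  subst heq
  rw [← M.union_eq]
  exact hP

namespace Tri

theorem affine_centroid (t : Tri) (f : E2 →ᵃ[ℝ] ℝ) :
    f t.centroid = (f (t.vtx 0) + f (t.vtx 1) + f (t.vtx 2)) / 3 := by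
  rw [affine_apply_eq f t.centroid, affine_apply_eq f (t.vtx 0), affine_apply_eq f (t.vtx 1),
    affine_apply_eq f (t.vtx 2), centroid_apply, centroid_apply]
  ring

theorem setIntegral_affine (t : Tri) (f : E2 →ᵃ[ℝ] ℝ) :
    ∫ x in t.carrier, f x = t.area * f t.centroid := by
  have h := t.setIntegral_mul f (AffineMap.const ℝ E2 1)
  simp only [AffineMap.const_apply, mul_one, affine_midpoint] at h
  rw [h, affine_centroid]
  ring

end Tri

theorem sum_sum_mul_sq_sub {ι : Type*} (S : Finset ι) (a u : ι → ℝ)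
    (h : ∑ i ∈ S, a i * u i = 0) :
    ∑ i ∈ S, ∑ j ∈ S, a i * a j * (u i - u j) ^ 2
      = 2 * (∑ i ∈ S, a i) * ∑ i ∈ S, a i * u i ^ 2 := by
  have h1 : ∀ i j, a i * a j * (u i - u j) ^ 2
      = a i * u i ^ 2 * a j - 2 * (a i * u i) * (a j * u j) + a i * (a j * u j ^ 2) := by
    intro i j
    ring
  simp only [h1, Finset.sum_add_distrib, Finset.sum_sub_distrib, ← Finset.mul_sum,
    ← Finset.sum_mul, h]
  ring

namespace Mesh

variable {Ω : Set E2} (M : Mesh Ω)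

theorem volume_interior_inter_closure {t : Tri} (ht : t ∈ M.tris) :
    volume.real (interior t.carrier ∩ closure Ω) = t.area := by
  rw [Set.inter_eq_left.2 (interior_subset.trans (M.carrier_subset_closure ht)),
    t.area_eq_interior]

theorem setIntegral_sq_le {t : Tri} (ht : t ∈ M.tris) (q : Tri → (E2 →ᵃ[ℝ] ℝ)) :
    ∫ x in t.carrier, q t x * q t x
      ≤ 2 * (t.area * q t t.centroid ^ 2)
        + 2 * M.meshSize ^ 2 * (t.area * ⟪gradh q t, gradh q t⟫) := by
  have hb : ∀ i j, i ≠ j → q t (midpoint ℝ (t.vtx i) (t.vtx j))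
      * q t (midpoint ℝ (t.vtx i) (t.vtx j))
      ≤ 2 * q t t.centroid ^ 2 + 2 * M.meshSize ^ 2 * ⟪gradh q t, gradh q t⟫ := by
    intro i j hij
    have h := sq_le_sq.2 ((M.abs_sub_centroid_le ht q
      (Tri.emid_mem_carrier (t.hasEdge_vtx hij))).trans (le_abs_self _))
    rw [real_inner_self_eq_norm_sq]
    simp only [emid] at h
    nlinarith [sq_nonneg (q t (midpoint ℝ (t.vtx i) (t.vtx j)) - 2 * q t t.centroid)]
  rw [t.setIntegral_mul]
  have h1 := hb 0 1 (by decide)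
  have h2 := hb 0 2 (by decide)
  have h3 := hb 1 2 (by decide)
  have := t.area_pos
  calc _ ≤ t.area / 3 * (3 * (2 * q t t.centroid ^ 2
        + 2 * M.meshSize ^ 2 * ⟪gradh q t, gradh q t⟫)) := by
        gcongr
        linarith
    _ = _ := by ring

end Mesh

/-- The discrete Poincaré inequality for nonconforming functions of mean zero. -/
theorem Mesh.exists_poincare {Ω : Set E2} (M₀ : Mesh Ω) (hΩo : IsOpen Ω) (hΩc : IsConnected Ω)
    (hΩb : Bornology.IsBounded Ω) {Creg : ℝ} (hC : 0 < Creg) :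
    ∃ C, 0 ≤ C ∧ ∀ M : Mesh Ω, M.Regular Creg → ∀ q : Tri → (E2 →ᵃ[ℝ] ℝ), M.IsP1nc q →
      M.MeanZero q → M.l2P1 q q ≤ C * M.l2P0 (gradh q) (gradh q) := by
  obtain ⟨C, hC0, hP⟩ := M₀.poincareOn_closure hΩo hΩc hΩb hC
  obtain ⟨D, hD⟩ := Metric.isBounded_iff.1 hΩb.closure
  have hΩf : volume (closure Ω) ≠ ⊤ := hΩb.closure.measure_lt_top.ne
  have hV : 0 < volume.real (closure Ω) :=
    ENNReal.toReal_pos ((hΩo.measure_pos volume hΩc.nonempty).trans_le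
      (measure_mono subset_closure)).ne' hΩf
  refine ⟨C / volume.real (closure Ω) + 2 * (D / Creg) ^ 2, by positivity,
    fun M hM q hq hq0 => ?_⟩
  have hh := M.meshSize_pos
  have hle : M.meshSize ≤ D / Creg := by
    rw [le_div_iff₀ hC, mul_comm]
    exact hM.mul_meshSize_le fun x hx y hy => hD hx hy
  have hmean : ∑ t ∈ M.tris, t.area * q t t.centroid = 0 := by
    rw [← hq0]
    exact Finset.sum_congr rfl fun t _ => (t.setIntegral_affine (q t)).symm
  have harea : ∑ t ∈ M.tris, t.area = volume.real (closure Ω) := by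
    rw [← M.sum_volume_interior_inter subset_rfl hΩf]
    exact Finset.sum_congr rfl fun t ht => (M.volume_interior_inter_closure ht).symm
  have hvar : M.variation q (closure Ω)
      = 2 * volume.real (closure Ω) * ∑ t ∈ M.tris, t.area * q t t.centroid ^ 2 := by
    rw [← harea, ← sum_sum_mul_sq_sub _ _ _ hmean]
    exact Finset.sum_congr rfl fun K hK => Finset.sum_congr rfl fun L hL => by
      rw [M.volume_interior_inter_closure hK, M.volume_interior_inter_closure hL]
  have hE := M.l2P0_self_nonneg (gradh q)
  have h1 : 2 * ∑ t ∈ M.tris, t.area * q t t.centroid ^ 2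
      ≤ C / volume.real (closure Ω) * M.l2P0 (gradh q) (gradh q) := by
    rw [div_mul_eq_mul_div, le_div_iff₀ hV]
    calc _ = M.variation q (closure Ω) := by rw [hvar]; ring
      _ ≤ _ := hP M hM q hq
  have h2 : M.l2P1 q q ≤ 2 * ∑ t ∈ M.tris, t.area * q t t.centroid ^ 2
      + 2 * M.meshSize ^ 2 * M.l2P0 (gradh q) (gradh q) := by
    rw [l2P0, Finset.mul_sum, Finset.mul_sum, ← Finset.sum_add_distrib]
    exact Finset.sum_le_sum fun t ht => M.setIntegral_sq_le ht q
  have h3 : 2 * M.meshSize ^ 2 * M.l2P0 (gradh q) (gradh q)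
      ≤ 2 * (D / Creg) ^ 2 * M.l2P0 (gradh q) (gradh q) := by gcongr
  linarith

/-- **Degenerate discrete inf-sup estimate**: there exists `C > 0` depending only on `Ω`
and `C_reg` such that for every admissible regular mesh and every `q_h ∈ P₁^{nc} ∩ L²₀`
there is a nonzero `v_h ∈ P₀` with `−(q_h, div_h v_h) ≥ C h ‖q_h‖_{1,h} ‖v_h‖_h`. -/
theorem degenerate_discrete_infsup
    {Ω : Set E2} (hΩo : IsOpen Ω) (hΩc : IsConnected Ω) (hΩb : Bornology.IsBounded Ω)
    (Creg : ℝ) (hCreg : 0 < Creg) :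
    ∃ C > 0, ∀ M : Mesh Ω, M.Regular Creg →
      ∀ q : Tri → (E2 →ᵃ[ℝ] ℝ), M.IsP1nc q → M.MeanZero q →
      ∃ (v : Tri → E2) (d : Tri → (E2 →ᵃ[ℝ] ℝ)),
        (∃ t ∈ M.tris, v t ≠ 0) ∧ M.IsDivh v d ∧
        C * M.meshSize * M.norm1h q * M.normh v ≤ -(M.l2P1 q d) := by
  by_cases hmesh : Nonempty (Mesh Ω)
  swap
  · exact ⟨1, one_pos, fun M => absurd ⟨M⟩ hmesh⟩
  obtain ⟨M₀⟩ := hmesh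
  obtain ⟨P, hP0, hP⟩ := M₀.exists_poincare hΩo hΩc hΩb hCreg
  set B : ℝ := (P + 1) * (12 / Creg ^ 4) with hB
  have hB0 : 0 < B := by positivity
  refine ⟨1 / Real.sqrt B, by positivity, fun M hM q hq hq0 => ?_⟩
  have hh := M.meshSize_pos
  have hE := M.l2P0_self_nonneg (gradh q)
  have hn1 : M.norm1h q ^ 2 ≤ (P + 1) * M.l2P0 (gradh q) (gradh q) := by
    have hq2 : 0 ≤ M.l2P1 q q := Finset.sum_nonneg fun t _ =>
      integral_nonneg fun x => mul_self_nonneg _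
    rw [Mesh.norm1h, Real.sq_sqrt (by positivity), Mesh.l2normP1, Mesh.l2normP0,
      Real.sq_sqrt hq2, Real.sq_sqrt hE]
    linarith [hP M hM q hq hq0]
  by_cases hg : ∃ t ∈ M.tris, gradh q t ≠ 0
  · obtain ⟨d, hd⟩ := M.exists_isDivh (gradh q)
    refine ⟨gradh q, d, hg, hd, ?_⟩
    rw [M.l2P1_isDivh hq hd, neg_neg]
    have hnh := hM.normh_sq_le hCreg (gradh q)
    have hsq : (M.meshSize * M.norm1h q * M.normh (gradh q)) ^ 2
        ≤ (Real.sqrt B * M.l2P0 (gradh q) (gradh q)) ^ 2 := by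
      calc _ = M.norm1h q ^ 2 * (M.meshSize ^ 2 * M.normh (gradh q) ^ 2) := by ring
        _ ≤ ((P + 1) * M.l2P0 (gradh q) (gradh q))
            * (12 / Creg ^ 4 * M.l2P0 (gradh q) (gradh q)) := by gcongr
        _ = _ := by rw [mul_pow, Real.sq_sqrt hB0.le, hB]; ring
    have hle := abs_le_of_sq_le_sq hsq (by positivity)
    have hs := Real.sqrt_pos.2 hB0
    calc _ = (M.meshSize * M.norm1h q * M.normh (gradh q)) / Real.sqrt B := by ring
      _ ≤ _ := by
        rw [div_le_iff₀ hs, mul_comm _ (Real.sqrt B)]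
        exact (le_abs_self _).trans hle
  · push Not at hg
    set v : Tri → E2 := fun _ => EuclideanSpace.single 0 1 with hv
    obtain ⟨d, hd⟩ := M.exists_isDivh v
    obtain ⟨t, ht⟩ := M.tris_nonempty
    refine ⟨v, d, ⟨t, ht, by simp [hv]⟩, hd, ?_⟩
    have h0 : ∀ w : Tri → E2, M.l2P0 w (gradh q) = 0 := fun w =>
      Finset.sum_eq_zero fun s hs => by rw [hg s hs, inner_zero_right, mul_zero]
    rw [h0, mul_zero] at hn1
    have : M.norm1h q = 0 := pow_eq_zero_iff two_ne_zero |>.1 (le_antisymm hn1 (sq_nonneg _))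
    rw [M.l2P1_isDivh hq hd, neg_neg, h0, this]
    simp

end
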